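/- arXiv:2409.03897 — 11 statements merged into one kernel-verified Lean document; each statement's English description precedes it below -/
import Mathlib

section
/- With Δ_t, Δ_0, P̄, P̃_i^k, V*, V_i^k as in the synchronous federated Q-learning setup, for every t ≥ 0 one has the exact error iteration Δ_{t+1} = (1−λ)^{t+1} Δ_0 + γλ ∑_{i=0}^{t} (1−λ)^{t−i} (1/K) ∑_{k=1}^{K} ((P̄ − P̃_i^k)V*) + γλ ∑_{i=0}^{t} (1−λ)^{t−i} (1/K) ∑_{k=1}^{K} (P̃_i^k (V* − V_i^k)), where the identity is between functions on S×A. -/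
open Finset

/-- Entrywise sup norm of a function on a finite nonempty index set. -/
noncomputable def supNorm {ι : Type*} [Fintype ι] [Nonempty ι] (f : ι → ℝ) : ℝ :=
  ⨆ i, |f i|

/-- Closed form of a first-order affine recursion. -/
lemma affine_recursion_closed_form {α : Type*} [CommRing α] (c : α) (x b : ℕ → α)
    (h : ∀ t, x (t + 1) = c * x t + b t) (t : ℕ) :
    x (t + 1) = c ^ (t + 1) * x 0 + ∑ i ∈ Finset.range (t + 1), c ^ (t - i) * b i := by
  induction t with
  | zero => simp [h]
  | succ t ih =>
    have hshift : ∑ i ∈ Finset.range (t + 1), c ^ (t + 1 - i) * b i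
        = c * ∑ i ∈ Finset.range (t + 1), c ^ (t - i) * b i := by
      rw [Finset.mul_sum]
      refine Finset.sum_congr rfl fun i hi => ?_
      rw [Nat.succ_sub (Nat.lt_succ_iff.mp (Finset.mem_range.mp hi)), pow_succ]
      ring
    rw [h, ih, Finset.sum_range_succ _ (t + 1), hshift, Nat.sub_self]
    ring

/-- The average over a nonempty finite family is unchanged when each entry is replaced by it. -/
lemma average_ite_average {K : ℕ} (hK : K ≠ 0) (c : Prop) [Decidable c] (f : Fin K → ℝ) :
    (∑ k, if c then (∑ j, f j) / K else f k) / K = (∑ k, f k) / K := by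
  have hK' : (K : ℝ) ≠ 0 := Nat.cast_ne_zero.mpr hK
  split_ifs
  · simp [mul_div_cancel₀ _ hK']
  · rfl

/-- **Error iteration for synchronous federated Q-learning.**
For every `t ≥ 0`,
`Δ_{t+1} = (1−λ)^{t+1} Δ_0 + γλ ∑_{i=0}^{t} (1−λ)^{t−i} (1/K) ∑_k ((P̄ − P̃_i^k)V*)
 + γλ ∑_{i=0}^{t} (1−λ)^{t−i} (1/K) ∑_k (P̃_i^k (V* − V_i^k))`,
as functions on `S × A`. -/
theorem error_iteration
    {S A : Type*} [Fintype S] [Nonempty S] [DecidableEq S] [Fintype A] [Nonempty A]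
    (γ lam : ℝ) (hγ : γ ∈ Set.Ioo (0:ℝ) 1) (hlam : lam ∈ Set.Ioc (0:ℝ) 1)
    (K : ℕ) (hK : 1 ≤ K) (E : ℕ) (hE : 1 ≤ E)
    (R : S × A → ℝ) (hR : ∀ p, R p ∈ Set.Icc (0:ℝ) 1)
    (P : Fin K → S × A → S → ℝ)
    (hPnn : ∀ k p s', 0 ≤ P k p s') (hPsum : ∀ k p, ∑ s', P k p s' = 1)
    (Pbar : S × A → S → ℝ)
    (hPbar : ∀ p s', Pbar p s' = (∑ k, P k p s') / K)
    (Qstar : S × A → ℝ)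
    (hQstar : ∀ p, Qstar p = R p + γ * ∑ s', Pbar p s' * (⨆ a, Qstar (s', a)))
    (Vstar : S → ℝ) (hVstar : ∀ s, Vstar s = ⨆ a, Qstar (s, a))
    (Ptil : ℕ → Fin K → S × A → S → ℝ)
    (hPtil : ∀ t k p, ∃ s', ∀ s'', Ptil t k p s'' = if s'' = s' then 1 else 0)
    (Q0 : S × A → ℝ)
    (Q : ℕ → Fin K → S × A → ℝ)
    (hQ0 : ∀ k, Q 0 k = Q0)
    (hQrec : ∀ t k p,
      Q (t+1) k p =
        if (t+1) % E = 0 then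
          (∑ j, ((1 - lam) * Q t j p
            + lam * (R p + γ * ∑ s', Ptil t j p s' * (⨆ a, Q t j (s', a))))) / K
        else
          (1 - lam) * Q t k p
            + lam * (R p + γ * ∑ s', Ptil t k p s' * (⨆ a, Q t k (s', a)))) :
    ∀ (t : ℕ) (p : S × A),
      Qstar p - (∑ k, Q (t+1) k p) / K
        = (1 - lam) ^ (t+1) * (Qstar p - Q0 p)
          + γ * lam * ∑ i ∈ Finset.range (t+1), (1 - lam) ^ (t - i) *
              ((∑ k, ((∑ s', Pbar p s' * Vstar s') - ∑ s', Ptil i k p s' * Vstar s')) / K)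
          + γ * lam * ∑ i ∈ Finset.range (t+1), (1 - lam) ^ (t - i) *
              ((∑ k, ∑ s', Ptil i k p s' * (Vstar s' - ⨆ a, Q i k (s', a))) / K) := by
  intro t p
  have hK0 : K ≠ 0 := by omega
  have hKr : (K : ℝ) ≠ 0 := Nat.cast_ne_zero.mpr hK0
  have hR' : R p = Qstar p - γ * ∑ s', Pbar p s' * Vstar s' := by
    simp only [hVstar]
    linarith [hQstar p]
  have hstep : ∀ t, Qstar p - (∑ k, Q (t+1) k p) / K
      = (1 - lam) * (Qstar p - (∑ k, Q t k p) / K)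
        + γ * lam *
          ((∑ k, ((∑ s', Pbar p s' * Vstar s') - ∑ s', Ptil t k p s' * Vstar s')) / K
            + (∑ k, ∑ s', Ptil t k p s' * (Vstar s' - ⨆ a, Q t k (s', a))) / K) := by
    intro t
    simp only [hQrec]
    rw [average_ite_average hK0, hR']
    simp only [mul_sub, mul_add, Finset.sum_add_distrib, Finset.sum_sub_distrib,
      ← Finset.mul_sum, Finset.sum_const, Finset.card_univ, Fintype.card_fin, nsmul_eq_mul]
    field_simp
    ring
  have hzero : Qstar p - (∑ k, Q 0 k p) / K = Qstar p - Q0 p := by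
    simp [hQ0, mul_div_cancel_left₀ _ hKr]
  rw [affine_recursion_closed_form _ (fun t => Qstar p - (∑ k, Q t k p) / K) _ hstep t]
  simp only [hzero]
  rw [add_assoc, ← mul_add, ← Finset.sum_add_distrib, Finset.mul_sum]
  congr 1
  exact Finset.sum_congr rfl fun i _ => by ring
end

section
/- For every t ≥ 0: if t mod E = 0 then ‖(1/K)∑_{k=1}^K P̃_t^k(V* − V_t^k)‖∞ ≤ ‖Δ_t‖∞; otherwise ‖(1/K)∑_{k=1}^K P̃_t^k(V* − V_t^k)‖∞ ≤ ‖Δ_{χ(t)}‖∞ + 2λ (1/K)∑_{k=1}^K ∑_{t'=χ(t)}^{t−1} ‖Δ_{t'}^k‖∞ + γλ (1/K)∑_{k=1}^K max_{(s,a)∈S×A} |∑_{t'=χ(t)}^{t−1} ((P̃_{t'}^k − P̄)V*)(s,a)| (with the convention that an empty sum equals 0). -/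
open Finset

theorem abs_le_supNorm {ι : Type*} [Fintype ι] [Nonempty ι] (f : ι → ℝ) (i : ι) :
    |f i| ≤ supNorm f :=
  le_ciSup (f := fun i => |f i|) (Set.finite_range _).bddAbove i

theorem supNorm_le {ι : Type*} [Fintype ι] [Nonempty ι] {f : ι → ℝ} {c : ℝ}
    (h : ∀ i, |f i| ≤ c) : supNorm f ≤ c :=
  ciSup_le h

/-- The maximum is nonexpansive in the sup norm. -/
theorem abs_ciSup_sub_ciSup_le {ι : Type*} [Finite ι] [Nonempty ι] {f g : ι → ℝ} {c : ℝ}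
    (h : ∀ i, |f i - g i| ≤ c) : |(⨆ i, f i) - ⨆ i, g i| ≤ c := by
  have hf : ⨆ i, f i ≤ (⨆ i, g i) + c := ciSup_le fun i => by
    linarith [(abs_le.mp (h i)).2, le_ciSup (Set.finite_range g).bddAbove i]
  have hg : ⨆ i, g i ≤ (⨆ i, f i) + c := ciSup_le fun i => by
    linarith [(abs_le.mp (h i)).1, le_ciSup (Set.finite_range f).bddAbove i]
  exact abs_le.mpr ⟨by linarith, by linarith⟩

theorem abs_sum_div_le_sum_div {K : ℕ} {f c : Fin K → ℝ} (h : ∀ k, |f k| ≤ c k) :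
    |(∑ k, f k) / K| ≤ (∑ k, c k) / K := by
  rw [abs_div, Nat.abs_cast]
  exact div_le_div_of_nonneg_right
    ((Finset.abs_sum_le_sum_abs _ _).trans (Finset.sum_le_sum fun k _ => h k)) K.cast_nonneg

theorem fin_sum_const_div {K : ℕ} (hK : 1 ≤ K) (c : ℝ) : (∑ _k : Fin K, c) / K = c := by
  have : (K : ℝ) ≠ 0 := by positivity
  simp [this]

/-- No multiple of `E` lies strictly after `t - t % E` and up to `t`. -/
theorem mod_ne_zero_of_sub_mod_lt {E t m : ℕ} (hE : 1 ≤ E) (hm : t - t % E < m) (hmt : m ≤ t) :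
    m % E ≠ 0 := fun h => by
  have h₁ : E ∣ m - (t - t % E) := Nat.dvd_sub (Nat.dvd_of_mod_eq_zero h) (Nat.dvd_sub_mod t)
  have h₂ := Nat.le_of_dvd (by omega) h₁
  have h₃ := Nat.mod_lt t hE
  have h₄ := Nat.mod_le t E
  omega

/-- For every `t ≥ 0`: if `t mod E = 0` then
`‖(1/K)∑_k P̃_t^k(V* − V_t^k)‖∞ ≤ ‖Δ_t‖∞`; otherwise
`‖(1/K)∑_k P̃_t^k(V* − V_t^k)‖∞ ≤ ‖Δ_{χ(t)}‖∞
  + 2λ (1/K)∑_k ∑_{t'=χ(t)}^{t−1} ‖Δ_{t'}^k‖∞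
  + γλ (1/K)∑_k max_{(s,a)} |∑_{t'=χ(t)}^{t−1} ((P̃_{t'}^k − P̄)V*)(s,a)|`. -/
theorem stepsize_push
    {S A : Type*} [Fintype S] [Nonempty S] [DecidableEq S] [Fintype A] [Nonempty A]
    (γ lam : ℝ) (hγ : γ ∈ Set.Ioo (0:ℝ) 1) (hlam : lam ∈ Set.Ioc (0:ℝ) 1)
    (K : ℕ) (hK : 1 ≤ K) (E : ℕ) (hE : 1 ≤ E)
    (R : S × A → ℝ) (hR : ∀ p, R p ∈ Set.Icc (0:ℝ) 1)
    (P : Fin K → S × A → S → ℝ)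
    (hPnn : ∀ k p s', 0 ≤ P k p s') (hPsum : ∀ k p, ∑ s', P k p s' = 1)
    (Pbar : S × A → S → ℝ)
    (hPbar : ∀ p s', Pbar p s' = (∑ k, P k p s') / K)
    (Qstar : S × A → ℝ)
    (hQstar : ∀ p, Qstar p = R p + γ * ∑ s', Pbar p s' * (⨆ a, Qstar (s', a)))
    (Vstar : S → ℝ) (hVstar : ∀ s, Vstar s = ⨆ a, Qstar (s, a))
    (Ptil : ℕ → Fin K → S × A → S → ℝ)
    (hPtil : ∀ t k p, ∃ s', ∀ s'', Ptil t k p s'' = if s'' = s' then 1 else 0)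
    (Q0 : S × A → ℝ)
    (Q : ℕ → Fin K → S × A → ℝ)
    (hQ0 : ∀ k, Q 0 k = Q0)
    (hQrec : ∀ t k p,
      Q (t+1) k p =
        if (t+1) % E = 0 then
          (∑ j, ((1 - lam) * Q t j p
            + lam * (R p + γ * ∑ s', Ptil t j p s' * (⨆ a, Q t j (s', a))))) / K
        else
          (1 - lam) * Q t k p
            + lam * (R p + γ * ∑ s', Ptil t k p s' * (⨆ a, Q t k (s', a)))) :
    ∀ t : ℕ,
      (t % E = 0 →
        supNorm (fun p => (∑ k, ∑ s', Ptil t k p s' * (Vstar s' - ⨆ a, Q t k (s', a))) / K)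
          ≤ supNorm (fun p => Qstar p - (∑ k, Q t k p) / K))
      ∧ (t % E ≠ 0 →
        supNorm (fun p => (∑ k, ∑ s', Ptil t k p s' * (Vstar s' - ⨆ a, Q t k (s', a))) / K)
          ≤ supNorm (fun p => Qstar p - (∑ k, Q (t - t % E) k p) / K)
            + 2 * lam * ((∑ k, ∑ t' ∈ Finset.Ico (t - t % E) t,
                supNorm (fun p => Qstar p - Q t' k p)) / K)
            + γ * lam * ((∑ k, ⨆ p : S × A,
                |∑ t' ∈ Finset.Ico (t - t % E) t,
                  ((∑ s', Ptil t' k p s' * Vstar s') - ∑ s', Pbar p s' * Vstar s')|) / K)) := by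
  obtain ⟨hγ0, hγ1⟩ := hγ
  have hlam0 : 0 ≤ lam := hlam.1.le
  choose σ hσ using hPtil
  have hrow : ∀ t k p (f : S → ℝ), ∑ s', Ptil t k p s' * f s' = f (σ t k p) := by
    intro t k p f
    simp [hσ]
  have hV : ∀ t k (c : ℝ), (∀ p, |Qstar p - Q t k p| ≤ c) →
      ∀ s, |Vstar s - ⨆ a, Q t k (s, a)| ≤ c := by
    intro t k c h s
    rw [hVstar]
    exact abs_ciSup_sub_ciSup_le fun a => h (s, a)
  have hsync : ∀ t, t % E = 0 → ∀ k p, (∑ j, Q t j p) / K = Q t k p := by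
    intro t ht k p
    have hconst : ∀ j, Q t j p = Q t k p := by
      intro j
      cases t with
      | zero => rw [hQ0, hQ0]
      | succ n => rw [hQrec n j, hQrec n k, if_pos ht, if_pos ht]
    simp_rw [hconst]
    exact fin_sum_const_div hK _
  intro t
  refine ⟨fun ht => supNorm_le fun p => ?_, fun _ => supNorm_le fun p => ?_⟩
  · refine (abs_sum_div_le_sum_div fun k => ?_).trans (fin_sum_const_div hK _).le
    rw [hrow t k p fun s' => Vstar s' - ⨆ a, Q t k (s', a)]
    refine hV t k _ (fun q => ?_) _
    rw [← hsync t ht k q]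
    exact abs_le_supNorm (fun p => Qstar p - (∑ k, Q t k p) / K) q
  · set χ := t - t % E with hχ
    have hχ0 : χ % E = 0 := Nat.mod_eq_zero_of_dvd (Nat.dvd_sub_mod t)
    have hχt : χ ≤ t := Nat.sub_le _ _
    have htel : ∀ k q, Qstar q - Q t k q = (Qstar q - Q χ k q)
        - lam * ∑ t' ∈ Finset.Ico χ t, ((Qstar q - Q t' k q)
          - γ * (Vstar (σ t' k q) - ⨆ a, Q t' k (σ t' k q, a)))
        - γ * lam * ∑ t' ∈ Finset.Ico χ t,
          ((∑ s', Ptil t' k q s' * Vstar s') - ∑ s', Pbar q s' * Vstar s') := by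
      intro k q
      have aux : ∀ n, χ ≤ n → n ≤ t → Qstar q - Q n k q = (Qstar q - Q χ k q)
          - lam * ∑ t' ∈ Finset.Ico χ n, ((Qstar q - Q t' k q)
            - γ * (Vstar (σ t' k q) - ⨆ a, Q t' k (σ t' k q, a)))
          - γ * lam * ∑ t' ∈ Finset.Ico χ n,
            ((∑ s', Ptil t' k q s' * Vstar s') - ∑ s', Pbar q s' * Vstar s') := by
        intro n hn
        induction n, hn using Nat.le_induction with
        | base => simp
        | succ n hn ih =>
          intro hnt
          have hstep := hQrec n k q
          rw [if_neg (mod_ne_zero_of_sub_mod_lt hE (by omega) hnt),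
            hrow n k q fun s' => ⨆ a, Q n k (s', a)] at hstep
          have hfix := hQstar q
          simp_rw [← hVstar] at hfix
          rw [Finset.sum_Ico_succ_top hn, Finset.sum_Ico_succ_top hn, hstep, hrow n k q Vstar]
          linear_combination ih (by omega) + lam * hfix
      exact aux t hχt le_rfl
    have hbound : ∀ k q, |Qstar q - Q t k q| ≤
        supNorm (fun p => Qstar p - (∑ k, Q χ k p) / K)
          + 2 * lam * (∑ t' ∈ Finset.Ico χ t, supNorm (fun p => Qstar p - Q t' k p))
          + γ * lam * (⨆ p : S × A, |∑ t' ∈ Finset.Ico χ t,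
              ((∑ s', Ptil t' k p s' * Vstar s') - ∑ s', Pbar p s' * Vstar s')|) := by
      intro k q
      rw [htel k q]
      refine (abs_sub _ _).trans (add_le_add ((abs_sub _ _).trans (add_le_add ?_ ?_)) ?_)
      · rw [← hsync χ hχ0 k q]
        exact abs_le_supNorm (fun p => Qstar p - (∑ k, Q χ k p) / K) q
      · rw [abs_mul, abs_of_nonneg hlam0, mul_comm 2 lam, mul_assoc]
        refine mul_le_mul_of_nonneg_left ?_ hlam0
        rw [Finset.mul_sum]
        refine (Finset.abs_sum_le_sum_abs _ _).trans (Finset.sum_le_sum fun t' _ => ?_)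
        have hΔ := abs_le_supNorm (fun p => Qstar p - Q t' k p)
        have hΔV := hV t' k _ hΔ (σ t' k q)
        refine (abs_sub _ _).trans ?_
        rw [abs_mul, abs_of_pos hγ0, two_mul]
        exact add_le_add (hΔ q)
          ((mul_le_of_le_one_left (abs_nonneg _) hγ1.le).trans hΔV)
      · rw [abs_mul, abs_of_nonneg (mul_nonneg hγ0.le hlam0)]
        exact mul_le_mul_of_nonneg_left (abs_le_supNorm (fun p => ∑ t' ∈ Finset.Ico χ t,
          ((∑ s', Ptil t' k p s' * Vstar s') - ∑ s', Pbar p s' * Vstar s')) q)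
          (mul_nonneg hγ0.le hlam0)
    refine (abs_sum_div_le_sum_div fun k =>
      (congrArg abs (hrow t k p fun s' => Vstar s' - ⨆ a, Q t k (s', a))).trans_le
        (hV t k _ (hbound k) _)).trans (le_of_eq ?_)
    rw [Finset.sum_add_distrib, Finset.sum_add_distrib, add_div, add_div,
      fin_sum_const_div hK, ← Finset.mul_sum, ← Finset.mul_sum, mul_div_assoc, mul_div_assoc]
end

section
/- For every agent k ∈ {1,…,K}, every time t ≥ 0, and every state s ∈ S, the drift of the local value estimate since the last synchronization satisfies |V_t^k(s) − V_{χ(t)}^k(s)| ≤ 2λ ∑_{t'=χ(t)}^{t−1} ‖Δ_{t'}^k‖∞ + γλ max_{(s',a')∈S×A} |∑_{t'=χ(t)}^{t−1} ((P̃_{t'}^k − P̄)V*)(s',a')| (with the convention that an empty sum equals 0). -/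
open Finset

theorem abs_iSup_sub_iSup_le {ι : Type*} [Finite ι] [Nonempty ι] {f g : ι → ℝ} {C : ℝ}
    (h : ∀ i, |f i - g i| ≤ C) : |(⨆ i, f i) - ⨆ i, g i| ≤ C := by
  have one_sided : ∀ {u v : ι → ℝ}, (∀ i, u i ≤ v i + C) → (⨆ i, u i) ≤ (⨆ i, v i) + C := by
    intro u v huv
    refine ciSup_le fun i => (huv i).trans ?_
    have := le_ciSup (Set.finite_range v).bddAbove i
    linarith
  have h₁ : (⨆ i, f i) ≤ (⨆ i, g i) + C :=
    one_sided fun i => by linarith [(abs_le.1 (h i)).2]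
  have h₂ : (⨆ i, g i) ≤ (⨆ i, f i) + C :=
    one_sided fun i => by linarith [(abs_le.1 (h i)).1]
  exact abs_le.2 ⟨by linarith, by linarith⟩

theorem succ_mod_ne_zero_of_mem_Ico {E t i : ℕ} (hE : 1 ≤ E)
    (hi : i ∈ Finset.Ico (t - t % E) t) : (i + 1) % E ≠ 0 := by
  obtain ⟨h₁, h₂⟩ := Finset.mem_Ico.1 hi
  intro h
  obtain ⟨c, hc⟩ := Nat.dvd_of_mod_eq_zero h
  have hdiv := Nat.div_add_mod t E
  have hlt := Nat.mod_lt t hE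
  have hlow : E * (t / E) < E * c := by omega
  have hc' : t / E + 1 ≤ c := Nat.lt_of_mul_lt_mul_left hlow
  have := Nat.mul_le_mul_left E hc'
  rw [Nat.mul_add] at this
  omega

/-- **Local value drift since the last synchronization.** For every agent `k`, time `t`,
and state `s`:
`|V_t^k(s) − V_{χ(t)}^k(s)| ≤ 2λ ∑_{t'=χ(t)}^{t−1} ‖Δ_{t'}^k‖∞
  + γλ max_{(s',a')} |∑_{t'=χ(t)}^{t−1} ((P̃_{t'}^k − P̄)V*)(s',a')|`. -/
theorem local_value_drift
    {S A : Type*} [Fintype S] [Nonempty S] [DecidableEq S] [Fintype A] [Nonempty A]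
    (γ lam : ℝ) (hγ : γ ∈ Set.Ioo (0:ℝ) 1) (hlam : lam ∈ Set.Ioc (0:ℝ) 1)
    (K : ℕ) (hK : 1 ≤ K) (E : ℕ) (hE : 1 ≤ E)
    (R : S × A → ℝ) (hR : ∀ p, R p ∈ Set.Icc (0:ℝ) 1)
    (P : Fin K → S × A → S → ℝ)
    (hPnn : ∀ k p s', 0 ≤ P k p s') (hPsum : ∀ k p, ∑ s', P k p s' = 1)
    (Pbar : S × A → S → ℝ)
    (hPbar : ∀ p s', Pbar p s' = (∑ k, P k p s') / K)
    (Qstar : S × A → ℝ)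
    (hQstar : ∀ p, Qstar p = R p + γ * ∑ s', Pbar p s' * (⨆ a, Qstar (s', a)))
    (Vstar : S → ℝ) (hVstar : ∀ s, Vstar s = ⨆ a, Qstar (s, a))
    (Ptil : ℕ → Fin K → S × A → S → ℝ)
    (hPtil : ∀ t k p, ∃ s', ∀ s'', Ptil t k p s'' = if s'' = s' then 1 else 0)
    (Q0 : S × A → ℝ)
    (Q : ℕ → Fin K → S × A → ℝ)
    (hQ0 : ∀ k, Q 0 k = Q0)
    (hQrec : ∀ t k p,
      Q (t+1) k p =
        if (t+1) % E = 0 then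
          (∑ j, ((1 - lam) * Q t j p
            + lam * (R p + γ * ∑ s', Ptil t j p s' * (⨆ a, Q t j (s', a))))) / K
        else
          (1 - lam) * Q t k p
            + lam * (R p + γ * ∑ s', Ptil t k p s' * (⨆ a, Q t k (s', a)))) :
    ∀ (k : Fin K) (t : ℕ) (s : S),
      |(⨆ a, Q t k (s, a)) - ⨆ a, Q (t - t % E) k (s, a)|
        ≤ 2 * lam * ∑ t' ∈ Finset.Ico (t - t % E) t, supNorm (fun p => Qstar p - Q t' k p)
          + γ * lam * ⨆ p : S × A,
              |∑ t' ∈ Finset.Ico (t - t % E) t,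
                ((∑ s', Ptil t' k p s' * Vstar s') - ∑ s', Pbar p s' * Vstar s')| := by
  intro k t s
  obtain ⟨hγ0, hγ1⟩ := hγ
  obtain ⟨hlam0, -⟩ := hlam
  set I := Finset.Ico (t - t % E) t with hI
  set N : ℕ → S × A → ℝ := fun i p =>
    (∑ s', Ptil i k p s' * Vstar s') - ∑ s', Pbar p s' * Vstar s' with hN
  have value_gap : ∀ i s', |(⨆ a, Q i k (s', a)) - Vstar s'|
      ≤ supNorm (fun p => Qstar p - Q i k p) := by
    intro i s'
    rw [hVstar]
    refine abs_iSup_sub_iSup_le fun a => ?_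
    rw [abs_sub_comm]
    exact abs_le_supNorm (fun p => Qstar p - Q i k p) (s', a)
  have step : ∀ i ∈ I, ∀ p, |Q (i + 1) k p - Q i k p - γ * lam * N i p|
      ≤ 2 * lam * supNorm (fun p => Qstar p - Q i k p) := by
    intro i hi p
    obtain ⟨s', hs'⟩ := hPtil i k p
    have hsample : ∀ V : S → ℝ, ∑ s'', Ptil i k p s'' * V s'' = V s' := fun V => by
      simp [hs']
    have hstar : Qstar p = R p + γ * ∑ s', Pbar p s' * Vstar s' := by
      simp only [hVstar]
      exact hQstar p
    have hdecomp : Q (i + 1) k p - Q i k p - γ * lam * N i p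
        = lam * ((Qstar p - Q i k p) + γ * ((⨆ a, Q i k (s', a)) - Vstar s')) := by
      rw [hQrec, if_neg (succ_mod_ne_zero_of_mem_Ico hE hi), hstar]
      simp only [hN, hsample]
      ring
    have h₁ := abs_le_supNorm (fun p => Qstar p - Q i k p) p
    have h₂ := value_gap i s'
    rw [hdecomp, abs_mul, abs_of_pos hlam0, mul_comm 2 lam, mul_assoc]
    refine mul_le_mul_of_nonneg_left ((abs_add_le _ _).trans ?_) hlam0.le
    rw [abs_mul, abs_of_pos hγ0, two_mul]
    exact add_le_add h₁ ((mul_le_of_le_one_left (abs_nonneg _) hγ1.le).trans h₂)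
  refine abs_iSup_sub_iSup_le fun a => ?_
  have htele : Q t k (s, a) - Q (t - t % E) k (s, a)
      = ∑ i ∈ I, (Q (i + 1) k (s, a) - Q i k (s, a) - γ * lam * N i (s, a))
        + γ * lam * ∑ i ∈ I, N i (s, a) := by
    rw [Finset.sum_sub_distrib, ← Finset.mul_sum, sub_add_cancel, hI,
      Finset.sum_Ico_sub (fun i => Q i k (s, a)) (Nat.sub_le _ _)]
  rw [htele]
  refine (abs_add_le _ _).trans (add_le_add ?_ ?_)
  · rw [Finset.mul_sum]
    exact (Finset.abs_sum_le_sum_abs _ _).trans (Finset.sum_le_sum fun i hi => step i hi _)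
  · rw [abs_mul, abs_of_pos (mul_pos hγ0 hlam0)]
    exact mul_le_mul_of_nonneg_left (abs_le_supNorm (fun p => ∑ i ∈ I, N i p) (s, a))
      (mul_pos hγ0 hlam0).le
end

section
/- In the Markov reward process setting, for every r ≥ 0 the error between consecutive synchronization rounds satisfies Δ_{(r+1)E} = Ā^{(E)} Δ_{rE} + ((I − Ā^{(E)}) − (I + Ā^{(1)} + ⋯ + Ā^{(E−1)})(I − Ā^{(1)})) Q*. -/
open Finset Matrix

/-- If `u` follows the affine recursion `v ↦ M *ᵥ v + b` on the window `[s, s + m]`, one further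
application of the affine map gives its `(m + 1)`-fold iterate at `u s`. -/
theorem affine_iterate_eq {S : Type*} [Fintype S] [DecidableEq S] (M : Matrix S S ℝ) (b : S → ℝ)
    (u : ℕ → S → ℝ) (s m : ℕ) (hu : ∀ i < m, u (s + i + 1) = M *ᵥ u (s + i) + b) :
    M *ᵥ u (s + m) + b = M ^ (m + 1) *ᵥ u s + (∑ l ∈ range (m + 1), M ^ l) *ᵥ b := by
  induction m with
  | zero => simp
  | succ m ih =>
    rw [← add_assoc, hu m m.lt_succ_self, ih fun i hi => hu i (by omega),
      Finset.sum_range_succ' _ (m + 1), pow_zero, mulVec_add, mulVec_mulVec, mulVec_mulVec,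
      Finset.mul_sum, add_mulVec, one_mulVec, ← pow_succ', add_assoc]
    simp only [pow_succ']

/-- **Error recursion between synchronization rounds (Markov reward process setting).**
For every `r ≥ 0`,
`Δ_{(r+1)E} = Ā^{(E)} Δ_{rE} + ((I − Ā^{(E)}) − (I + Ā^{(1)} + ⋯ + Ā^{(E−1)})(I − Ā^{(1)})) Q*`. -/
theorem error_recursion_between_syncs
    {S : Type*} [Fintype S] [Nonempty S] [DecidableEq S]
    (γ lam : ℝ) (hγ : γ ∈ Set.Ioo (0:ℝ) 1) (hlam : lam ∈ Set.Ioc (0:ℝ) 1)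
    (K E : ℕ) (hK : 1 ≤ K) (hE : 1 ≤ E)
    (R : S → ℝ)
    (P : Fin K → Matrix S S ℝ)
    (hPnn : ∀ k i j, 0 ≤ P k i j) (hPsum : ∀ k i, ∑ j, P k i j = 1)
    (Pbar : Matrix S S ℝ) (hPbar : Pbar = ((K : ℝ)⁻¹) • ∑ k, P k)
    (Qstar : S → ℝ) (hQstar : ((1 : Matrix S S ℝ) - γ • Pbar) *ᵥ Qstar = R)
    (A : Fin K → Matrix S S ℝ)
    (hA : ∀ k, A k = (1 - lam) • (1 : Matrix S S ℝ) + (lam * γ) • P k)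
    (Abar : ℕ → Matrix S S ℝ) (hAbar : ∀ ℓ, Abar ℓ = ((K : ℝ)⁻¹) • ∑ k, (A k) ^ ℓ)
    (Q0 : S → ℝ) (Q : ℕ → Fin K → S → ℝ)
    (hQ0 : ∀ k, Q 0 k = Q0)
    (hQrec : ∀ t k, Q (t + 1) k =
      if (t + 1) % E = 0 then ((K : ℝ)⁻¹) • ∑ j, (A j *ᵥ Q t j + lam • R)
      else A k *ᵥ Q t k + lam • R)
    (Δ : ℕ → S → ℝ) (hΔ : ∀ t, Δ t = Qstar - ((K : ℝ)⁻¹) • ∑ k, Q t k) :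
    ∀ r : ℕ,
      Δ ((r + 1) * E)
        = Abar E *ᵥ Δ (r * E)
          + (((1 : Matrix S S ℝ) - Abar E)
              - (∑ ℓ ∈ Finset.range E, Abar ℓ) * ((1 : Matrix S S ℝ) - Abar 1)) *ᵥ Qstar := by
  obtain ⟨m, rfl⟩ : ∃ m, E = m + 1 := ⟨E - 1, by omega⟩
  have hK0 : (K : ℝ) ≠ 0 := by positivity
  have avg_const (v : S → ℝ) : ((K : ℝ)⁻¹) • ∑ _k : Fin K, v = v := by
    rw [Finset.sum_const, Finset.card_univ, Fintype.card_fin, ← Nat.cast_smul_eq_nsmul ℝ,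
      inv_smul_smul₀ hK0]
  have hAbar_one : Abar 1 = (1 - lam) • (1 : Matrix S S ℝ) + (lam * γ) • Pbar := by
    rw [hAbar, hPbar]
    simp only [pow_one, hA, Finset.sum_add_distrib, ← Finset.smul_sum, Finset.sum_const,
      Finset.card_univ, Fintype.card_fin, ← Nat.cast_smul_eq_nsmul ℝ, smul_add]
    rw [smul_comm (1 - lam) (K : ℝ), inv_smul_smul₀ hK0,
      smul_comm ((K : ℝ)⁻¹) (lam * γ)]
  have hlamR : lam • R = ((1 : Matrix S S ℝ) - Abar 1) *ᵥ Qstar := by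
    rw [← hQstar, ← smul_mulVec, hAbar_one]
    congr 1
    module
  have hsync (r : ℕ) (k j : Fin K) : Q (r * (m + 1)) k = Q (r * (m + 1)) j := by
    cases r with
    | zero => simp [hQ0]
    | succ r =>
      have h : (r + 1) * (m + 1) = r * (m + 1) + m + 1 := by ring
      have hmod : (r * (m + 1) + m + 1) % (m + 1) = 0 := by simp [← h]
      rw [h, hQrec, hQrec, if_pos hmod, if_pos hmod]
  intro r
  obtain ⟨q, hq⟩ : ∃ q, ∀ k, Q (r * (m + 1)) k = q :=
    ⟨Q (r * (m + 1)) ⟨0, hK⟩, fun k => hsync r k _⟩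
  have hlocal (k : Fin K) : A k *ᵥ Q (r * (m + 1) + m) k + lam • R
      = A k ^ (m + 1) *ᵥ q + (∑ l ∈ range (m + 1), A k ^ l) *ᵥ (lam • R) := by
    rw [affine_iterate_eq (A k) (lam • R) (fun t => Q t k) (r * (m + 1)) m ?_, hq]
    · intro i hi
      have hmod : (r * (m + 1) + i + 1) % (m + 1) ≠ 0 := by
        rw [add_assoc, Nat.mul_add_mod_self_right, Nat.mod_eq_of_lt (by omega)]
        omega
      simp only [hQrec (r * (m + 1) + i), if_neg hmod]
  have hstep (k : Fin K) : Q ((r + 1) * (m + 1)) k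
      = Abar (m + 1) *ᵥ q + (∑ l ∈ range (m + 1), Abar l) *ᵥ (lam • R) := by
    have h : (r + 1) * (m + 1) = r * (m + 1) + m + 1 := by ring
    have hmod : (r * (m + 1) + m + 1) % (m + 1) = 0 := by simp [← h]
    rw [h, hQrec, if_pos hmod]
    simp only [hlocal, hAbar, Finset.sum_add_distrib, smul_add, ← Finset.smul_sum, smul_mulVec,
      ← sum_mulVec]
    rw [Finset.sum_comm]
  rw [hΔ, hΔ]
  simp only [hstep, hq, avg_const]
  rw [hlamR, mulVec_mulVec, sub_mulVec _ (_ * _), sub_mulVec, one_mulVec, mulVec_sub]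
  abel
end

section
/- In the two-state construction, for every ℓ ≥ 0 one has the eigen-decomposition Ā^{(ℓ)} = α_ℓ (I − P̄) + β_ℓ P̄, where ν₁ = 1−(1+γ)λ, ν₂ = 1−(1−γ)λ, α_ℓ = (ν₁^ℓ + ν₂^ℓ)/2, and β_ℓ = ν₂^ℓ. -/
open Finset Matrix

theorem sum_fin_even_parity {M : Type*} [AddCommMonoid M] (m : ℕ) (x y : M) :
    ∑ k : Fin (m + m), (if (k : ℕ) % 2 = 0 then x else y) = m • (x + y) := by
  rw [Fin.sum_univ_eq_sum_range (fun k => if k % 2 = 0 then x else y)]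
  induction m with
  | zero => simp
  | succ m ih =>
    have h₀ : (m + m) % 2 = 0 := by omega
    have h₁ : (m + m + 1) % 2 ≠ 0 := by omega
    rw [show m + 1 + (m + 1) = m + m + 1 + 1 by ring, sum_range_succ, sum_range_succ, ih,
      if_pos h₀, if_neg h₁, succ_nsmul, add_assoc]

theorem inv_smul_sum_fin_even_parity {M : Type*} [AddCommGroup M] [Module ℝ M] {K : ℕ}
    (hK : K ≠ 0) (hKeven : Even K) (x y : M) :
    (K : ℝ)⁻¹ • ∑ k : Fin K, (if (k : ℕ) % 2 = 0 then x else y) = (2 : ℝ)⁻¹ • (x + y) := by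
  obtain ⟨m, rfl⟩ := hKeven
  have hm : (m : ℝ) ≠ 0 := by
    rintro h
    exact hK (by simp_all)
  rw [sum_fin_even_parity, ← Nat.cast_smul_eq_nsmul ℝ, smul_smul]
  congr 1
  push_cast
  field_simp
  norm_num

theorem symm_circulant_two_pow (a b : ℝ) (n : ℕ) :
    !![a, b; b, a] ^ n =
      !![((a - b) ^ n + (a + b) ^ n) / 2, ((a + b) ^ n - (a - b) ^ n) / 2;
         ((a + b) ^ n - (a - b) ^ n) / 2, ((a - b) ^ n + (a + b) ^ n) / 2] := by
  induction n with
  | zero => simp [one_fin_two]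
  | succ n ih =>
    rw [pow_succ, ih]
    ext i j
    fin_cases i <;> fin_cases j <;> simp [Matrix.mul_apply, Fin.sum_univ_two] <;> ring

/-- **Eigen-decomposition of `Ā^{(ℓ)}` in the two-state construction.**
`Ā^{(ℓ)} = α_ℓ (I − P̄) + β_ℓ P̄` with `α_ℓ = (ν₁^ℓ + ν₂^ℓ)/2`, `β_ℓ = ν₂^ℓ`,
`ν₁ = 1−(1+γ)λ`, `ν₂ = 1−(1−γ)λ`. -/
theorem Abar_eigendecomposition
    (γ lam : ℝ) (hγ : γ ∈ Set.Ioo (0:ℝ) 1) (hlam : lam ∈ Set.Ioc (0:ℝ) (1 / (1 + γ)))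
    (K : ℕ) (hK : 2 ≤ K) (hKeven : Even K)
    (P : Fin K → Matrix (Fin 2) (Fin 2) ℝ)
    (hP : ∀ k : Fin K, P k =
      if (k : ℕ) % 2 = 0 then (1 : Matrix (Fin 2) (Fin 2) ℝ) else !![0, 1; 1, 0])
    (Pbar : Matrix (Fin 2) (Fin 2) ℝ) (hPbar : Pbar = ((K : ℝ)⁻¹) • ∑ k, P k)
    (A : Fin K → Matrix (Fin 2) (Fin 2) ℝ)
    (hA : ∀ k, A k = (1 - lam) • (1 : Matrix (Fin 2) (Fin 2) ℝ) + (lam * γ) • P k)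
    (Abar : ℕ → Matrix (Fin 2) (Fin 2) ℝ)
    (hAbar : ∀ ℓ, Abar ℓ = ((K : ℝ)⁻¹) • ∑ k, (A k) ^ ℓ) :
    ∀ ℓ : ℕ,
      Abar ℓ
        = (((1 - (1 + γ) * lam) ^ ℓ + (1 - (1 - γ) * lam) ^ ℓ) / 2) •
            ((1 : Matrix (Fin 2) (Fin 2) ℝ) - Pbar)
          + ((1 - (1 - γ) * lam) ^ ℓ) • Pbar := by
  intro ℓ
  have hK0 : K ≠ 0 := by omega
  have hpow : ∀ k, A k ^ ℓ = if (k : ℕ) % 2 = 0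
      then ((1 - (1 - γ) * lam) • (1 : Matrix (Fin 2) (Fin 2) ℝ)) ^ ℓ
      else !![1 - lam, lam * γ; lam * γ, 1 - lam] ^ ℓ := by
    intro k
    rw [hA, hP]
    split_ifs
    · rw [← add_smul]
      ring_nf
    · congr 1
      ext i j
      fin_cases i <;> fin_cases j <;> simp
  have hPbar' : Pbar = (2 : ℝ)⁻¹ • (1 + !![0, 1; 1, 0]) := by
    rw [hPbar, sum_congr rfl fun k _ => hP k, inv_smul_sum_fin_even_parity hK0 hKeven]
  rw [hAbar, sum_congr rfl fun k _ => hpow k, inv_smul_sum_fin_even_parity hK0 hKeven,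
    symm_circulant_two_pow, smul_pow, one_pow, hPbar',
    show 1 - lam - lam * γ = 1 - (1 + γ) * lam by ring,
    show 1 - lam + lam * γ = 1 - (1 - γ) * lam by ring]
  generalize (1 - (1 + γ) * lam) ^ ℓ = u
  generalize (1 - (1 - γ) * lam) ^ ℓ = v
  ext i j
  fin_cases i <;> fin_cases j <;> simp <;> ring
end

section
/- In the two-state construction with zero initialization Q_0 = 0, for every E ≥ 1 and every r ≥ 0 the synchronized error admits the closed form Δ_{rE} = (α_E^r + κ_E (1−α_E^r)/(1−α_E)) (I − P̄)Q* + β_E^r P̄ Q*, where ν₁ = 1−(1+γ)λ, ν₂ = 1−(1−γ)λ, α_E = (ν₁^E + ν₂^E)/2 (note 1 − α_E > 0 since λ > 0), β_E = ν₂^E, and κ_E = −(γ/2)((1−ν₂^E)/(1−γ) − (1−ν₁^E)/(1+γ)). -/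
open Finset Matrix

/-- The average of a parity-dependent quantity over an even number of agents. -/
lemma average_parity {K : ℕ} (hK : 0 < K) (hKeven : Even K) (x y : ℝ) :
    (K : ℝ)⁻¹ * ∑ k : Fin K, (if (k : ℕ) % 2 = 0 then x else y) = (x + y) / 2 := by
  obtain ⟨m, rfl⟩ := hKeven
  have sum_range_parity : ∀ n : ℕ, ∑ k ∈ range (n + n), (if k % 2 = 0 then x else y)
      = n * (x + y) := by
    intro n
    induction n with
    | zero => simp
    | succ n ih =>
      have h₀ : (n + n) % 2 = 0 := by omega
      have h₁ : (n + n + 1) % 2 ≠ 0 := by omega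
      rw [show n + 1 + (n + 1) = n + n + 1 + 1 by ring, sum_range_succ, sum_range_succ, ih,
        if_pos h₀, if_neg h₁]
      push_cast
      ring
  have hm : (m : ℝ) ≠ 0 := by
    have : m ≠ 0 := by omega
    exact_mod_cast this
  rw [Fin.sum_univ_eq_sum_range (fun k => if k % 2 = 0 then x else y), sum_range_parity]
  push_cast
  field_simp
  ring

/-- One communication round of scalar affine iterations that are averaged every `E` steps: between
two synchronizations agent `k` runs `E` local steps towards its own fixed point `b / c k`. -/
lemma averaged_affine_round {K E : ℕ} (hE : 1 ≤ E) {c : Fin K → ℝ} (hc : ∀ k, c k ≠ 0)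
    {lam b y : ℝ} {x : ℕ → Fin K → ℝ}
    (hx : ∀ t k, x (t + 1) k =
      if (t + 1) % E = 0 then (K : ℝ)⁻¹ * ∑ j, ((1 - c j * lam) * x t j + lam * b)
      else (1 - c k * lam) * x t k + lam * b)
    {r : ℕ} (hy : ∀ k, x (r * E) k = y) (k : Fin K) :
    x ((r + 1) * E) k = (K : ℝ)⁻¹ *
      ∑ j, ((1 - c j * lam) ^ E * y + b / c j * (1 - (1 - c j * lam) ^ E)) := by
  have step : ∀ l j, (1 - c j * lam) *
        ((1 - c j * lam) ^ l * y + b / c j * (1 - (1 - c j * lam) ^ l)) + lam * b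
      = (1 - c j * lam) ^ (l + 1) * y + b / c j * (1 - (1 - c j * lam) ^ (l + 1)) := by
    intro l j
    have := hc j
    field_simp
    ring
  have inner : ∀ l, l < E → ∀ j, x (r * E + l) j =
      (1 - c j * lam) ^ l * y + b / c j * (1 - (1 - c j * lam) ^ l) := by
    intro l
    induction l with
    | zero => intro _ j; simp [hy j]
    | succ l ih =>
      intro hl j
      have hmod : (r * E + l + 1) % E ≠ 0 := by
        rw [add_assoc, Nat.mul_add_mod', Nat.mod_eq_of_lt hl]
        omega
      rw [← add_assoc, hx, if_neg hmod, ih (by omega), step]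
  obtain ⟨l, rfl⟩ : ∃ l, E = l + 1 := ⟨E - 1, by omega⟩
  have hmod : (r * (l + 1) + l + 1) % (l + 1) = 0 := by
    rw [show r * (l + 1) + l + 1 = (r + 1) * (l + 1) by ring, Nat.mul_mod_left]
  rw [show (r + 1) * (l + 1) = r * (l + 1) + l + 1 by ring, hx, if_pos hmod]
  congr 1
  refine sum_congr rfl fun j _ => ?_
  rw [inner l (by omega), step]

/-- Averaged affine iterations whose contraction rates depend only on the parity of the agent,
started at zero, at the synchronization times. -/
lemma averaged_affine_closed_form {K E : ℕ} (hK : 0 < K) (hKeven : Even K) (hE : 1 ≤ E)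
    {c₀ c₁ lam b α : ℝ} (hc₀ : c₀ ≠ 0) (hc₁ : c₁ ≠ 0) {x : ℕ → Fin K → ℝ} (hx₀ : ∀ k, x 0 k = 0)
    (hx : ∀ t k, x (t + 1) k =
      if (t + 1) % E = 0 then (K : ℝ)⁻¹ *
        ∑ j : Fin K, ((1 - (if (j : ℕ) % 2 = 0 then c₀ else c₁) * lam) * x t j + lam * b)
      else (1 - (if (k : ℕ) % 2 = 0 then c₀ else c₁) * lam) * x t k + lam * b)
    (hα : α = ((1 - c₀ * lam) ^ E + (1 - c₁ * lam) ^ E) / 2) (hα₁ : 1 - α ≠ 0)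
    (r : ℕ) (k : Fin K) :
    x (r * E) k = (1 - α ^ r) / (1 - α) *
      ((b / c₀ * (1 - (1 - c₀ * lam) ^ E) + b / c₁ * (1 - (1 - c₁ * lam) ^ E)) / 2) := by
  induction r generalizing k with
  | zero => simp [hx₀]
  | succ r ih =>
    have hc : ∀ k : Fin K, (if (k : ℕ) % 2 = 0 then c₀ else c₁) ≠ 0 := by
      intro k
      split_ifs <;> assumption
    rw [averaged_affine_round hE hc hx ih]
    set u := b / c₀ * (1 - (1 - c₀ * lam) ^ E)
    set v := b / c₁ * (1 - (1 - c₁ * lam) ^ E)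
    set y := (1 - α ^ r) / (1 - α) * ((u + v) / 2) with hy
    have hsplit : ∀ j : Fin K,
        (1 - (if (j : ℕ) % 2 = 0 then c₀ else c₁) * lam) ^ E * y
          + b / (if (j : ℕ) % 2 = 0 then c₀ else c₁)
            * (1 - (1 - (if (j : ℕ) % 2 = 0 then c₀ else c₁) * lam) ^ E)
        = if (j : ℕ) % 2 = 0 then (1 - c₀ * lam) ^ E * y + u else (1 - c₁ * lam) ^ E * y + v := by
      intro j
      split_ifs <;> rfl
    simp only [hsplit]
    rw [average_parity hK hKeven]
    have hαy : ((1 - c₀ * lam) ^ E * y + u + ((1 - c₁ * lam) ^ E * y + v)) / 2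
        = α * y + (u + v) / 2 := by
      rw [hα]
      ring
    rw [hαy, hy]
    field_simp
    ring

/-- **Closed form of the synchronized error in the two-state construction with zero
initialization.** For every `r ≥ 0`,
`Δ_{rE} = (α_E^r + κ_E (1−α_E^r)/(1−α_E)) (I − P̄)Q* + β_E^r P̄ Q*`. -/
theorem synchronized_error_closed_form
    (γ lam : ℝ) (hγ : γ ∈ Set.Ioo (0:ℝ) 1) (hlam : lam ∈ Set.Ioc (0:ℝ) (1 / (1 + γ)))
    (K : ℕ) (hK : 2 ≤ K) (hKeven : Even K)
    (P : Fin K → Matrix (Fin 2) (Fin 2) ℝ)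
    (hP : ∀ k : Fin K, P k =
      if (k : ℕ) % 2 = 0 then (1 : Matrix (Fin 2) (Fin 2) ℝ) else !![0, 1; 1, 0])
    (Pbar : Matrix (Fin 2) (Fin 2) ℝ) (hPbar : Pbar = ((K : ℝ)⁻¹) • ∑ k, P k)
    (A : Fin K → Matrix (Fin 2) (Fin 2) ℝ)
    (hA : ∀ k, A k = (1 - lam) • (1 : Matrix (Fin 2) (Fin 2) ℝ) + (lam * γ) • P k)
    (Abar : ℕ → Matrix (Fin 2) (Fin 2) ℝ)
    (hAbar : ∀ ℓ, Abar ℓ = ((K : ℝ)⁻¹) • ∑ k, (A k) ^ ℓ)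
    (E : ℕ) (hE : 1 ≤ E)
    (R : Fin 2 → ℝ)
    (Qstar : Fin 2 → ℝ)
    (hQstar : ((1 : Matrix (Fin 2) (Fin 2) ℝ) - γ • Pbar) *ᵥ Qstar = R)
    (Q : ℕ → Fin K → Fin 2 → ℝ)
    (hQ0 : ∀ k, Q 0 k = 0)
    (hQrec : ∀ t k, Q (t + 1) k =
      if (t + 1) % E = 0 then ((K : ℝ)⁻¹) • ∑ j, (A j *ᵥ Q t j + lam • R)
      else A k *ᵥ Q t k + lam • R)
    (Δ : ℕ → Fin 2 → ℝ) (hΔ : ∀ t, Δ t = Qstar - ((K : ℝ)⁻¹) • ∑ k, Q t k)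
    (ν₁ ν₂ αE βE κE : ℝ)
    (hν₁ : ν₁ = 1 - (1 + γ) * lam) (hν₂ : ν₂ = 1 - (1 - γ) * lam)
    (hαE : αE = (ν₁ ^ E + ν₂ ^ E) / 2) (hβE : βE = ν₂ ^ E)
    (hκE : κE = -(γ / 2) * ((1 - ν₂ ^ E) / (1 - γ) - (1 - ν₁ ^ E) / (1 + γ))) :
    ∀ r : ℕ,
      Δ (r * E)
        = (αE ^ r + κE * (1 - αE ^ r) / (1 - αE)) •
            (((1 : Matrix (Fin 2) (Fin 2) ℝ) - Pbar) *ᵥ Qstar)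
          + (βE ^ r) • (Pbar *ᵥ Qstar) := by
  obtain ⟨hγ₀, hγ₁⟩ := hγ
  obtain ⟨hlam₀, hlam₁⟩ := hlam
  have hK₀ : 0 < K := by omega
  have hsub : 1 - γ ≠ 0 := by linarith
  have hadd : 1 + γ ≠ 0 := by linarith
  have hlamle : lam * (1 + γ) ≤ 1 := (le_div_iff₀ (by linarith)).mp hlam₁
  have hE₀ : E ≠ 0 := by omega
  have hν₁E : ν₁ ^ E < 1 := pow_lt_one₀ (by rw [hν₁]; linarith) (by rw [hν₁]; nlinarith) hE₀
  have hν₂E : ν₂ ^ E < 1 := pow_lt_one₀ (by rw [hν₂]; nlinarith) (by rw [hν₂]; nlinarith) hE₀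
  have hα : 1 - αE ≠ 0 := by rw [hαE]; linarith
  have hβ : 1 - βE ≠ 0 := by rw [hβE]; linarith
  have hPbar' : Pbar = !![1 / 2, 1 / 2; 1 / 2, 1 / 2] := by
    have hentry : ∀ i j, Pbar i j
        = ((1 : Matrix (Fin 2) (Fin 2) ℝ) i j + (!![0, 1; 1, 0] : Matrix (Fin 2) (Fin 2) ℝ) i j)
          / 2 := by
      intro i j
      rw [← average_parity hK₀ hKeven, hPbar, Matrix.smul_apply, Matrix.sum_apply, smul_eq_mul]
      congr 1
      refine sum_congr rfl fun k _ => ?_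
      rw [hP]
      split_ifs <;> rfl
    ext i j
    rw [hentry]
    fin_cases i <;> fin_cases j <;> simp
  have hR₀ := congrFun hQstar 0
  have hR₁ := congrFun hQstar 1
  simp [hPbar'] at hR₀ hR₁
  have local_step : ∀ (k : Fin K) (q : Fin 2 → ℝ),
      (A k *ᵥ q + lam • R) 0 + (A k *ᵥ q + lam • R) 1
          = (1 - (if (k : ℕ) % 2 = 0 then 1 - γ else 1 - γ) * lam) * (q 0 + q 1)
            + lam * ((1 - γ) * (Qstar 0 + Qstar 1)) ∧
      (A k *ᵥ q + lam • R) 0 - (A k *ᵥ q + lam • R) 1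
          = (1 - (if (k : ℕ) % 2 = 0 then 1 - γ else 1 + γ) * lam) * (q 0 - q 1)
            + lam * (Qstar 0 - Qstar 1) := by
    intro k q
    rw [hA, hP]
    split_ifs <;>
      simp [← hR₀, ← hR₁] <;>
      constructor <;> ring
  have hsum := averaged_affine_closed_form (x := fun t k => Q t k 0 + Q t k 1) (α := βE)
    (lam := lam) (b := (1 - γ) * (Qstar 0 + Qstar 1)) hK₀ hKeven hE hsub hsub (by simp [hQ0])
    (by
      intro t k
      simp only [← (local_step _ _).1, hQrec t k]
      split_ifs
      · simp only [Pi.smul_apply, Finset.sum_apply, smul_eq_mul, ← mul_add, ← sum_add_distrib]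
      · rfl)
    (by rw [hβE, hν₂]; ring) hβ
  have hdiff := averaged_affine_closed_form (x := fun t k => Q t k 0 - Q t k 1) (α := αE)
    (lam := lam) (b := Qstar 0 - Qstar 1) hK₀ hKeven hE hsub hadd (by simp [hQ0])
    (by
      intro t k
      simp only [← (local_step _ _).2, hQrec t k]
      split_ifs
      · simp only [Pi.smul_apply, Finset.sum_apply, smul_eq_mul, ← mul_sub, ← sum_sub_distrib]
      · rfl)
    (by rw [hαE, hν₁, hν₂]; ring) hα
  intro r
  have hKne : (K : ℝ) ≠ 0 := by exact_mod_cast hK₀.ne'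
  have average_const : ∀ (f : Fin K → ℝ) (y : ℝ), (∀ k, f k = y) → (K : ℝ)⁻¹ * ∑ k, f k = y := by
    intro f y hf
    simp [hf, hKne]
  have hΔapply : ∀ i, Δ (r * E) i = Qstar i - (K : ℝ)⁻¹ * ∑ k, Q (r * E) k i := by
    intro i
    simp [hΔ, Finset.sum_apply]
  have hS := average_const _ _ (hsum r)
  have hD := average_const _ _ (hdiff r)
  rw [sum_add_distrib, mul_add] at hS
  rw [sum_sub_distrib, mul_sub] at hD
  rw [← hν₂, ← hβE] at hS
  rw [← hν₂, ← hν₁] at hD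
  have hS' : Δ (r * E) 0 + Δ (r * E) 1 = βE ^ r * (Qstar 0 + Qstar 1) := by
    have hfix : (1 - βE ^ r) / (1 - βE) * (((1 - γ) * (Qstar 0 + Qstar 1) / (1 - γ) * (1 - βE)
        + (1 - γ) * (Qstar 0 + Qstar 1) / (1 - γ) * (1 - βE)) / 2)
        = (1 - βE ^ r) * (Qstar 0 + Qstar 1) := by
      field_simp
      ring
    rw [hfix] at hS
    rw [hΔapply, hΔapply]
    linarith
  have hD' : Δ (r * E) 0 - Δ (r * E) 1
      = (αE ^ r + κE * (1 - αE ^ r) / (1 - αE)) * (Qstar 0 - Qstar 1) := by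
    have hfix : ((Qstar 0 - Qstar 1) / (1 - γ) * (1 - ν₂ ^ E)
        + (Qstar 0 - Qstar 1) / (1 + γ) * (1 - ν₁ ^ E)) / 2
        = (1 - αE - κE) * (Qstar 0 - Qstar 1) := by
      rw [hαE, hκE]
      field_simp
      ring
    rw [hfix] at hD
    have hcoeff : (αE ^ r + κE * (1 - αE ^ r) / (1 - αE)) * (Qstar 0 - Qstar 1)
        = (Qstar 0 - Qstar 1)
          - (1 - αE ^ r) / (1 - αE) * ((1 - αE - κE) * (Qstar 0 - Qstar 1)) := by
      field_simp
      ring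
    rw [hcoeff, hΔapply, hΔapply]
    linarith
  set a := αE ^ r + κE * (1 - αE ^ r) / (1 - αE)
  ext i
  fin_cases i <;>
    simp [hPbar', dotProduct, Fin.sum_univ_two] <;>
    linarith
end

section
/- For every fixed E ≥ 1, the function λ ↦ κ_E/(1−α_E) is monotonically nonincreasing on (0, 1/(1+γ)): if 0 < λ ≤ λ' < 1/(1+γ) then κ_E(λ)/(1−α_E(λ)) ≥ κ_E(λ')/(1−α_E(λ')), where κ_E(λ) and α_E(λ) denote the quantities computed with stepsize λ (note 1 − α_E(λ) > 0 for λ > 0). -/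
open Finset

/-- For `0 ≤ p ≤ q`, the ratio `x ^ n / ∑ k ≤ n, x ^ k` at `p` is at most its value at `q`. -/
lemma pow_mul_geom_sum_le {p q : ℝ} (hp : 0 ≤ p) (hpq : p ≤ q) (n : ℕ) :
    p ^ n * ∑ k ∈ range (n + 1), q ^ k ≤ q ^ n * ∑ k ∈ range (n + 1), p ^ k := by
  rw [mul_sum, mul_sum]
  refine sum_le_sum fun k hk => ?_
  obtain ⟨m, rfl⟩ := Nat.exists_eq_add_of_le (Nat.lt_succ_iff.mp (mem_range.mp hk))
  have h : p ^ m ≤ q ^ m := pow_le_pow_left₀ hp hpq m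
  have h' : 0 ≤ p ^ k * q ^ k := mul_nonneg (pow_nonneg hp k) (pow_nonneg (hp.trans hpq) k)
  calc p ^ (k + m) * q ^ k = p ^ k * q ^ k * p ^ m := by ring
    _ ≤ p ^ k * q ^ k * q ^ m := mul_le_mul_of_nonneg_left h h'
    _ = q ^ (k + m) * p ^ k := by ring

/-- For `0 < b ≤ a`, the ratio of `1 - (1 - a x) ^ (n + 1)` to `1 - (1 - b x) ^ (n + 1)`
is antitone on `(0, 1 / a)`. -/
lemma antitoneOn_one_sub_pow_div {a b : ℝ} (hb : 0 < b) (hba : b ≤ a) (n : ℕ) :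
    AntitoneOn (fun x : ℝ => (1 - (1 - a * x) ^ (n + 1)) / (1 - (1 - b * x) ^ (n + 1)))
      (Set.Ioo 0 (1 / a)) := by
  have ha : 0 < a := hb.trans_le hba
  have hax : ∀ x ∈ Set.Ioo 0 (1 / a), 0 < 1 - a * x := fun x hx => by
    have := (lt_div_iff₀ ha).mp hx.2
    linarith
  have hle : ∀ x ∈ Set.Ioo 0 (1 / a), 1 - a * x ≤ 1 - b * x := fun x hx => by
    have := mul_le_mul_of_nonneg_right hba hx.1.le
    linarith
  have hpos : ∀ x ∈ Set.Ioo 0 (1 / a), 0 < 1 - (1 - b * x) ^ (n + 1) := fun x hx => by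
    have := mul_pos hb hx.1
    exact sub_pos.mpr (pow_lt_one₀ ((hax x hx).le.trans (hle x hx)) (by linarith) (by simp))
  have hd : ∀ c x : ℝ, HasDerivAt (fun x : ℝ => 1 - (1 - c * x) ^ (n + 1))
      ((n + 1) * c * (1 - c * x) ^ n) x := fun c x => by
    have h := ((((hasDerivAt_id' x).const_mul c).const_sub 1).fun_pow (n + 1)).const_sub 1
    refine h.congr_deriv ?_
    push_cast [Nat.add_sub_cancel]
    ring
  have hdq := fun x hx => (hd a x).fun_div (hd b x) (hpos x hx).ne'
  refine antitoneOn_of_deriv_nonpos (convex_Ioo _ _)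
    (fun x hx => (hdq x hx).continuousAt.continuousWithinAt) ?_ ?_
  · rw [interior_Ioo]
    exact fun x hx => (hdq x hx).differentiableAt.differentiableWithinAt
  · rw [interior_Ioo]
    intro x hx
    rw [(hdq x hx).deriv]
    refine div_nonpos_of_nonpos_of_nonneg ?_ (sq_nonneg _)
    have hgeom : ∀ c : ℝ, 1 - (1 - c * x) ^ (n + 1)
        = c * x * ∑ k ∈ range (n + 1), (1 - c * x) ^ k := fun c => by
      rw [← mul_neg_geom_sum]
      ring
    have hmain := pow_mul_geom_sum_le (hax x hx).le (hle x hx) n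
    rw [hgeom a, hgeom b]
    have hc : 0 ≤ ((n : ℝ) + 1) * a * b * x := by
      have := hx.1
      positivity
    have := mul_le_mul_of_nonneg_left hmain hc
    linarith

/-- **Monotonicity of `κ_E/(1−α_E)` in the stepsize.** For every fixed `E ≥ 1`, the map
`λ ↦ κ_E(λ)/(1−α_E(λ))` is monotonically nonincreasing on `(0, 1/(1+γ))`: if
`0 < λ ≤ λ' < 1/(1+γ)` then `κ_E(λ)/(1−α_E(λ)) ≥ κ_E(λ')/(1−α_E(λ'))`. -/
theorem kappa_over_one_sub_alpha_antitone
    (γ : ℝ) (hγ : γ ∈ Set.Ioo (0:ℝ) 1)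
    (E : ℕ) (hE : 1 ≤ E)
    (κE αE : ℝ → ℝ)
    (hκE : ∀ l : ℝ, κE l =
      -(γ / 2) * ((1 - (1 - (1 - γ) * l) ^ E) / (1 - γ)
        - (1 - (1 - (1 + γ) * l) ^ E) / (1 + γ)))
    (hαE : ∀ l : ℝ, αE l = ((1 - (1 + γ) * l) ^ E + (1 - (1 - γ) * l) ^ E) / 2) :
    ∀ l l' : ℝ, 0 < l → l ≤ l' → l' < 1 / (1 + γ) →
      κE l' / (1 - αE l') ≤ κE l / (1 - αE l) := by
  intro l l' hl hll' hl'
  obtain ⟨hγ0, hγ1⟩ := hγ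
  obtain ⟨n, rfl⟩ := Nat.exists_eq_add_of_le' hE
  have hb : 0 < 1 - γ := by linarith
  have ha : 0 < 1 + γ := by linarith
  have hpos : ∀ c x : ℝ, 0 < c → c ≤ 1 + γ → 0 < x → x < 1 / (1 + γ) →
      0 < 1 - (1 - c * x) ^ (n + 1) := fun c x hc hca hx hxa => by
    have h1 := (lt_div_iff₀ ha).mp hxa
    have h2 := mul_le_mul_of_nonneg_right hca hx.le
    have h3 := mul_pos hc hx
    exact sub_pos.mpr (pow_lt_one₀ (by linarith) (by linarith) (by simp))
  have hla : l < 1 / (1 + γ) := hll'.trans_lt hl'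
  have hl0 : 0 < l' := hl.trans_le hll'
  have hmono := antitoneOn_one_sub_pow_div hb (by linarith : 1 - γ ≤ 1 + γ) n
    ⟨hl, hla⟩ ⟨hl0, hl'⟩ hll'
  have hA := hpos _ l ha le_rfl hl hla
  have hA' := hpos _ l' ha le_rfl hl0 hl'
  have hB := hpos _ l hb (by linarith) hl hla
  have hB' := hpos _ l' hb (by linarith) hl0 hl'
  have hα : ∀ x, 1 - αE x = ((1 - (1 - (1 + γ) * x) ^ (n + 1))
      + (1 - (1 - (1 - γ) * x) ^ (n + 1))) / 2 := fun x => by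
    rw [hαE]
    ring
  rw [hα, hα, hκE, hκE]
  dsimp only at hmono
  generalize 1 - (1 - (1 + γ) * l) ^ (n + 1) = A at *
  generalize 1 - (1 - (1 + γ) * l') ^ (n + 1) = A' at *
  generalize 1 - (1 - (1 - γ) * l) ^ (n + 1) = B at *
  generalize 1 - (1 - (1 - γ) * l') ^ (n + 1) = B' at *
  rw [div_le_div_iff₀ hB' hB] at hmono
  rw [div_le_div_iff₀ (by positivity) (by positivity), ← sub_nonneg]
  have key : -(γ / 2) * (B / (1 - γ) - A / (1 + γ)) * ((A' + B') / 2)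
      - -(γ / 2) * (B' / (1 - γ) - A' / (1 + γ)) * ((A + B) / 2)
      = γ / 4 * (1 / (1 - γ) + 1 / (1 + γ)) * (A * B' - A' * B) := by
    ring
  rw [key]
  exact mul_nonneg (by positivity) (sub_nonneg.mpr hmono)
end

section
/- For every E ≥ 1 and every λ ∈ (0, 1/(1+γ)], |κ_E/(1−α_E)| ≤ γ²/(1−γ²). -/
open Finset

/-- **Upper bound on `|κ_E/(1−α_E)|`.** For every `E ≥ 1` and every
`λ ∈ (0, 1/(1+γ)]`, `|κ_E/(1−α_E)| ≤ γ²/(1−γ²)`. -/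
theorem kappa_over_one_sub_alpha_upper_bound
    (γ lam : ℝ) (hγ : γ ∈ Set.Ioo (0:ℝ) 1) (hlam : lam ∈ Set.Ioc (0:ℝ) (1 / (1 + γ)))
    (ν₁ ν₂ : ℝ) (hν₁ : ν₁ = 1 - (1 + γ) * lam) (hν₂ : ν₂ = 1 - (1 - γ) * lam)
    (α : ℕ → ℝ) (hα : ∀ ℓ, α ℓ = (ν₁ ^ ℓ + ν₂ ^ ℓ) / 2)
    (β : ℕ → ℝ) (hβ : ∀ ℓ, β ℓ = ν₂ ^ ℓ)
    (κ : ℕ → ℝ)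
    (hκ : ∀ E, κ E = -(γ / 2) * ((1 - ν₂ ^ E) / (1 - γ) - (1 - ν₁ ^ E) / (1 + γ))) :
    ∀ E : ℕ, 1 ≤ E → |κ E / (1 - α E)| ≤ γ ^ 2 / (1 - γ ^ 2) := by
  obtain ⟨hγ₀, hγ₁⟩ := hγ
  obtain ⟨hlam₀, hlam₁⟩ := hlam
  have hlam₂ : (1 + γ) * lam ≤ 1 := by
    rw [le_div_iff₀ (by linarith)] at hlam₁
    linarith
  have hν₁_nonneg : 0 ≤ ν₁ := by linarith
  have hν : ν₁ ≤ ν₂ := by nlinarith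
  have hν₂_lt : ν₂ < 1 := by nlinarith
  intro E hE
  have hpow : ν₁ ^ E ≤ ν₂ ^ E := pow_le_pow_left₀ hν₁_nonneg hν E
  have hpow_lt : ν₂ ^ E < 1 := pow_lt_one₀ (hν₁_nonneg.trans hν) hν₂_lt (by omega)
  have hdiv : (1 - ν₁ ^ E) / (1 + γ) ≤ (1 - ν₂ ^ E) / (1 - γ) := by
    have h₁ : (1 - ν₁ ^ E) / (1 + γ) = lam * ∑ i ∈ range E, ν₁ ^ i := by
      rw [div_eq_iff (by linarith), ← mul_neg_geom_sum ν₁ E, hν₁]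
      ring
    have h₂ : (1 - ν₂ ^ E) / (1 - γ) = lam * ∑ i ∈ range E, ν₂ ^ i := by
      rw [div_eq_iff (by linarith), ← mul_neg_geom_sum ν₂ E, hν₂]
      ring
    rw [h₁, h₂]
    exact mul_le_mul_of_nonneg_left
      (sum_le_sum fun i _ => pow_le_pow_left₀ hν₁_nonneg hν i) hlam₀.le
  have hden : 0 < 1 - α E := by
    rw [hα]
    linarith
  have hκ_nonpos : κ E ≤ 0 := by
    rw [hκ]
    exact mul_nonpos_of_nonpos_of_nonneg (by linarith) (sub_nonneg.2 hdiv)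
  have hgap : γ ^ 2 / (1 - γ ^ 2) * (1 - α E) - -κ E =
      γ * (ν₂ ^ E - ν₁ ^ E) / (2 * ((1 - γ) * (1 + γ))) := by
    have h₁ : 1 - γ ≠ 0 := by linarith
    have h₂ : 1 + γ ≠ 0 := by linarith
    rw [hκ, hα, show 1 - γ ^ 2 = (1 - γ) * (1 + γ) by ring]
    field_simp
    ring
  have hgap_nonneg : 0 ≤ γ * (ν₂ ^ E - ν₁ ^ E) / (2 * ((1 - γ) * (1 + γ))) := by
    have h₁ : 0 < 1 - γ := by linarith
    have h₂ := sub_nonneg.2 hpow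
    positivity
  rw [abs_div, abs_of_nonpos hκ_nonpos, abs_of_pos hden, div_le_iff₀ hden]
  linarith
end

section
/- For every E ≥ 1, if (1+γ)λ ≤ 1/(2E) then |κ_E/(1−α_E)| ≥ λγ²(E−1)/4. -/
open Finset

/-- The convexity bound for powers, with the slope taken at the smaller point. -/
theorem mul_pow_mul_sub_le_pow_succ_sub {a b : ℝ} (ha : 0 ≤ a) (hab : a ≤ b) (n : ℕ) :
    ((n : ℝ) + 1) * a ^ n * (b - a) ≤ b ^ (n + 1) - a ^ (n + 1) := by
  induction n with
  | zero => simp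
  | succ k ih =>
    have hpow : 0 ≤ b ^ (k + 1) - a ^ (k + 1) := sub_nonneg.2 (pow_le_pow_left₀ ha hab _)
    have h1 := mul_le_mul_of_nonneg_left ih ha
    have h2 := mul_nonneg (sub_nonneg.2 hab) hpow
    push_cast
    calc ((k : ℝ) + 1 + 1) * a ^ (k + 1) * (b - a)
        = a * (((k : ℝ) + 1) * a ^ k * (b - a)) + a ^ (k + 1) * (b - a) := by ring
      _ ≤ a * (b ^ (k + 1) - a ^ (k + 1)) + (b - a) * (b ^ (k + 1) - a ^ (k + 1))
          + a ^ (k + 1) * (b - a) := by linarith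
      _ = b ^ (k + 1 + 1) - a ^ (k + 1 + 1) := by ring

/-- If `n (1 - a) ≤ 1/2`, then the geometric sums of length `n` at `a ≤ b` differ by at least
`n (n - 1) (b - a) / 4`. -/
theorem mul_sub_div_four_le_geom_sum_sub {a b : ℝ} (ha : 0 ≤ a) (ha1 : a ≤ 1) (hab : a ≤ b)
    (n : ℕ) (hn : n * (1 - a) ≤ 1 / 2) :
    n * ((n : ℝ) - 1) * (b - a) / 4 ≤ ∑ i ∈ range n, b ^ i - ∑ i ∈ range n, a ^ i := by
  induction n with
  | zero => simp
  | succ k ih =>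
    push_cast at hn ⊢
    have ih := ih (by linarith)
    have hterm : (k : ℝ) * (b - a) / 2 ≤ b ^ k - a ^ k := by
      cases k with
      | zero => simp
      | succ m =>
        push_cast at hn ⊢
        have hb := one_add_mul_le_pow (show (-2 : ℝ) ≤ a - 1 by linarith) m
        rw [add_sub_cancel] at hb
        have hhalf : 1 / 2 ≤ a ^ m := by linarith
        have hc : 0 ≤ ((m : ℝ) + 1) * (b - a) :=
          mul_nonneg (by positivity) (sub_nonneg.2 hab)
        have h1 := mul_le_mul_of_nonneg_left hhalf hc
        linarith [mul_pow_mul_sub_le_pow_succ_sub ha hab m]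
    rw [sum_range_succ, sum_range_succ]
    linarith

/-- **Lower bound on `|κ_E/(1−α_E)|`.** For every `E ≥ 1`, if `(1+γ)λ ≤ 1/(2E)` then
`|κ_E/(1−α_E)| ≥ λγ²(E−1)/4`. -/
theorem kappa_over_one_sub_alpha_lower_bound
    (γ lam : ℝ) (hγ : γ ∈ Set.Ioo (0:ℝ) 1) (hlam : lam ∈ Set.Ioc (0:ℝ) (1 / (1 + γ)))
    (ν₁ ν₂ : ℝ) (hν₁ : ν₁ = 1 - (1 + γ) * lam) (hν₂ : ν₂ = 1 - (1 - γ) * lam)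
    (α : ℕ → ℝ) (hα : ∀ ℓ, α ℓ = (ν₁ ^ ℓ + ν₂ ^ ℓ) / 2)
    (β : ℕ → ℝ) (hβ : ∀ ℓ, β ℓ = ν₂ ^ ℓ)
    (κ : ℕ → ℝ)
    (hκ : ∀ E, κ E = -(γ / 2) * ((1 - ν₂ ^ E) / (1 - γ) - (1 - ν₁ ^ E) / (1 + γ))) :
    ∀ E : ℕ, 1 ≤ E → (1 + γ) * lam ≤ 1 / (2 * E) →
      lam * γ ^ 2 * ((E : ℝ) - 1) / 4 ≤ |κ E / (1 - α E)| := by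
  intro E hE hsmall
  obtain ⟨hγ0, hγ1⟩ := hγ
  have hlam0 : 0 < lam := hlam.1
  have hE1 : (1 : ℝ) ≤ E := by exact_mod_cast hE
  have hx : (E : ℝ) * ((1 + γ) * lam) ≤ 1 / 2 := by
    rw [le_div_iff₀ (by positivity)] at hsmall
    linarith
  have hx0 : 0 < (1 + γ) * lam := by positivity
  have hγlam : 0 < γ * lam := by positivity
  have hy0 : 0 < (1 - γ) * lam := mul_pos (by linarith) hlam0
  have hx1 : (1 + γ) * lam ≤ 1 / 2 := by nlinarith
  have hν₁0 : 0 < ν₁ := by linarith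
  have hν₁1 : ν₁ ≤ 1 := by linarith
  have hν : ν₁ ≤ ν₂ := by linarith
  have hdiff := mul_sub_div_four_le_geom_sum_sub hν₁0.le hν₁1 hν E (by rw [hν₁]; linarith)
  have hg₁ := mul_neg_geom_sum ν₁ E
  have hg₂ := mul_neg_geom_sum ν₂ E
  have hS₂ : ∑ i ∈ range E, ν₂ ^ i ≤ E := by
    have := sum_le_sum fun i (_ : i ∈ range E) =>
      pow_le_one₀ (n := i) (hν₁0.le.trans hν) (by linarith : ν₂ ≤ 1)
    simpa using this
  have hS₁ : 0 < ∑ i ∈ range E, ν₁ ^ i :=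
    sum_pos (fun i _ => pow_pos hν₁0 i) (nonempty_range_iff.2 (by omega))
  set S₁ := ∑ i ∈ range E, ν₁ ^ i
  set S₂ := ∑ i ∈ range E, ν₂ ^ i
  have hν₁' : 1 - ν₁ = (1 + γ) * lam := by linarith
  have hν₂' : 1 - ν₂ = (1 - γ) * lam := by linarith
  have hsub : ν₂ - ν₁ = 2 * γ * lam := by linarith
  rw [hν₁'] at hg₁
  rw [hν₂'] at hg₂
  rw [hsub] at hdiff
  have hS : 0 ≤ S₂ - S₁ := by
    refine le_trans ?_ hdiff
    have : 0 ≤ (E : ℝ) - 1 := by linarith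
    positivity
  have hD : 0 < (1 + γ) * S₁ + (1 - γ) * S₂ :=
    add_pos (by positivity) (mul_pos (by linarith) (by linarith))
  have hD2 : (1 + γ) * S₁ + (1 - γ) * S₂ ≤ 2 * E := by
    linarith [mul_nonneg hγ0.le hS]
  have hratio : κ E / (1 - α E) = -(γ * (S₂ - S₁) / ((1 + γ) * S₁ + (1 - γ) * S₂)) := by
    have hκE : κ E = -(lam / 2 * (γ * (S₂ - S₁))) := by
      have h1 : 1 - γ ≠ 0 := by linarith
      have h2 : 1 + γ ≠ 0 := by linarith
      rw [hκ, ← hg₁, ← hg₂]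
      field_simp
    have hαE : 1 - α E = lam / 2 * ((1 + γ) * S₁ + (1 - γ) * S₂) := by
      rw [hα]
      linarith
    rw [hκE, hαE, neg_div, mul_div_mul_left _ _ (by positivity)]
  rw [hratio, abs_neg]
  refine le_trans ?_ (le_abs_self _)
  rw [le_div_iff₀ hD]
  calc lam * γ ^ 2 * ((E : ℝ) - 1) / 4 * ((1 + γ) * S₁ + (1 - γ) * S₂)
      ≤ lam * γ ^ 2 * ((E : ℝ) - 1) / 4 * (2 * E) := by
        have : 0 ≤ (E : ℝ) - 1 := by linarith
        gcongr
    _ = γ * (E * ((E : ℝ) - 1) * (2 * γ * lam) / 4) := by ring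
    _ ≤ γ * (S₂ - S₁) := by gcongr
end

section
/- Large-stepsize regime: let E ≥ 1, r ≥ 2, and suppose log r / ((1−γ) r E) ≤ λ ≤ 1/(1+γ). Then (1 + |κ_E/(1−α_E)|) · α_E^r ≤ ν₂^{rE}/(1−γ²) ≤ 1/((1−γ²) r). -/
open Finset

/-- **Slow rate due to environment heterogeneity (large stepsize).** Let `E ≥ 1`, `r ≥ 2`,
and suppose `log r/((1−γ)rE) ≤ λ ≤ 1/(1+γ)`. Then
`(1 + |κ_E/(1−α_E)|)·α_E^r ≤ ν₂^{rE}/(1−γ²) ≤ 1/((1−γ²)r)`. -/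
theorem slow_rate_large_stepsize
    (γ lam : ℝ) (hγ : γ ∈ Set.Ioo (0:ℝ) 1) (hlam : lam ∈ Set.Ioc (0:ℝ) (1 / (1 + γ)))
    (ν₁ ν₂ : ℝ) (hν₁ : ν₁ = 1 - (1 + γ) * lam) (hν₂ : ν₂ = 1 - (1 - γ) * lam)
    (α : ℕ → ℝ) (hα : ∀ ℓ, α ℓ = (ν₁ ^ ℓ + ν₂ ^ ℓ) / 2)
    (β : ℕ → ℝ) (hβ : ∀ ℓ, β ℓ = ν₂ ^ ℓ)
    (κ : ℕ → ℝ)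
    (hκ : ∀ E, κ E = -(γ / 2) * ((1 - ν₂ ^ E) / (1 - γ) - (1 - ν₁ ^ E) / (1 + γ)))
    (E r : ℕ) (hE : 1 ≤ E) (hr : 2 ≤ r)
    (hlam_large : Real.log r / ((1 - γ) * r * E) ≤ lam) :
    (1 + |κ E / (1 - α E)|) * α E ^ r ≤ ν₂ ^ (r * E) / (1 - γ ^ 2)
    ∧ ν₂ ^ (r * E) / (1 - γ ^ 2) ≤ 1 / ((1 - γ ^ 2) * r) := by
  obtain ⟨hγ0, hγ1⟩ := hγ
  obtain ⟨hl0, hl1⟩ := hlam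
  have hγ2 : 0 < 1 - γ ^ 2 := by nlinarith
  have hν₁0 : 0 ≤ ν₁ := by
    rw [le_div_iff₀ (by linarith)] at hl1
    rw [hν₁]
    linarith
  have hν : ν₁ ≤ ν₂ := by
    rw [hν₁, hν₂]
    nlinarith [mul_pos hγ0 hl0]
  have hν₂0 : 0 ≤ ν₂ := hν₁0.trans hν
  have hν₂1 : ν₂ < 1 := by
    rw [hν₂]
    nlinarith [mul_pos (sub_pos.2 hγ1) hl0]
  constructor
  · have hab : ν₁ ^ E ≤ ν₂ ^ E := pow_le_pow_left₀ hν₁0 hν E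
    have ha : 0 ≤ ν₁ ^ E := pow_nonneg hν₁0 E
    have hb : ν₂ ^ E < 1 := pow_lt_one₀ hν₂0 hν₂1 (by omega)
    have hgeom : ∑ i ∈ range E, ν₁ ^ i ≤ ∑ i ∈ range E, ν₂ ^ i :=
      sum_le_sum fun i _ => pow_le_pow_left₀ hν₁0 hν i
    have hq : (1 - ν₁ ^ E) / (1 + γ) = lam * ∑ i ∈ range E, ν₁ ^ i := by
      rw [div_eq_iff (by linarith), ← mul_neg_geom_sum, hν₁]
      ring
    have hp : (1 - ν₂ ^ E) / (1 - γ) = lam * ∑ i ∈ range E, ν₂ ^ i := by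
      rw [div_eq_iff (by linarith), ← mul_neg_geom_sum, hν₂]
      ring
    have hκ0 : κ E ≤ 0 := by
      rw [hκ, hp, hq]
      nlinarith [mul_le_mul_of_nonneg_left hgeom hl0.le]
    have hα1 : 0 < 1 - α E := by
      rw [hα]
      linarith
    have hκα : -κ E * (1 - γ ^ 2) ≤ γ ^ 2 * (1 - α E) := by
      have hγm : 1 - γ ≠ 0 := by linarith
      have hγp : 1 + γ ≠ 0 := by linarith
      have h : -κ E * (1 - γ ^ 2)
          = γ / 2 * ((1 + γ) * (1 - ν₂ ^ E) - (1 - γ) * (1 - ν₁ ^ E)) := by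
        rw [hκ]
        field_simp
        ring
      rw [h, hα]
      nlinarith [mul_le_mul_of_nonneg_left hab hγ0.le]
    have hfactor : 1 + |κ E / (1 - α E)| ≤ 1 / (1 - γ ^ 2) := by
      rw [abs_div, abs_of_nonpos hκ0, abs_of_pos hα1]
      have h : -κ E / (1 - α E) ≤ γ ^ 2 / (1 - γ ^ 2) := (div_le_div_iff₀ hα1 hγ2).2 hκα
      have h' : 1 / (1 - γ ^ 2) = 1 + γ ^ 2 / (1 - γ ^ 2) := by
        field_simp
        ring
      linarith
    have hα0 : 0 ≤ α E := by
      rw [hα]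
      linarith
    have hαb : α E ≤ ν₂ ^ E := by
      rw [hα]
      linarith
    calc (1 + |κ E / (1 - α E)|) * α E ^ r
        ≤ 1 / (1 - γ ^ 2) * (ν₂ ^ E) ^ r := by gcongr
      _ = ν₂ ^ (r * E) / (1 - γ ^ 2) := by
        rw [← pow_mul, mul_comm E r]
        ring
  · have hr0 : (0 : ℝ) < r := by exact_mod_cast (by omega : 0 < r)
    have hE0 : (0 : ℝ) < E := by exact_mod_cast (by omega : 0 < E)
    have hlog : Real.log r ≤ lam * ((1 - γ) * r * E) :=
      (div_le_iff₀ (mul_pos (mul_pos (sub_pos.2 hγ1) hr0) hE0)).1 hlam_large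
    have hexp : ν₂ ≤ Real.exp (-((1 - γ) * lam)) := by
      have := Real.add_one_le_exp (-((1 - γ) * lam))
      rw [hν₂]
      linarith
    have hpow : ν₂ ^ (r * E) ≤ 1 / r := by
      calc ν₂ ^ (r * E) ≤ Real.exp (-((1 - γ) * lam)) ^ (r * E) :=
            pow_le_pow_left₀ hν₂0 hexp _
        _ = Real.exp (((r * E : ℕ) : ℝ) * -((1 - γ) * lam)) := (Real.exp_nat_mul _ _).symm
        _ ≤ Real.exp (-Real.log r) := by
            apply Real.exp_le_exp.2
            push_cast
            linarith
        _ = 1 / r := by rw [Real.exp_neg, Real.exp_log hr0, one_div]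
    calc ν₂ ^ (r * E) / (1 - γ ^ 2) ≤ 1 / r / (1 - γ ^ 2) := by gcongr
      _ = 1 / ((1 - γ ^ 2) * r) := by rw [div_div, mul_comm]
end

section
/- Lower bound on the convergence rate of synchronous federated Q-learning with heterogeneous environments: in the two-state construction with zero initialization Q_0 = 0, assume E ≥ 2, λ ∈ (0, 1/(1+γ)], (I−P̄)R ≠ 0, and P̄R ≠ 0, and set c_R = min{‖(I−P̄)R‖₂, ‖P̄R‖₂/(1−γ)} > 0. Then for every integer r ≥ 2 satisfying log r ≥ 4E(γ+2)/((1+γ)γ²(E−1)) and (1+γ)·log r/((1−γ)rE) ≤ 1/(2E), the error at T = rE satisfies ‖Δ_T‖∞ ≥ (c_R/(√2·e))·(E/T), where ‖·‖∞ is the entrywise sup norm of the vector Δ_T ∈ ℝ² and e is Euler's number. In particular, for any time-invariant stepsize λ ≤ 1/(1+γ), the ℓ_∞ error cannot decay faster than order E/T. -/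
open Finset Matrix

/-- Averaging a two-valued alternating sequence of even length. -/
lemma inv_mul_sum_alternating {K : ℕ} (hK : 2 ≤ K) (hKeven : Even K) (x y : ℝ) :
    ((K : ℝ)⁻¹) * ∑ k : Fin K, (if (k : ℕ) % 2 = 0 then x else y) = (x + y) / 2 := by
  obtain ⟨m, rfl⟩ := hKeven
  have hsum : ∀ m : ℕ, ∑ k ∈ range (m + m), (if k % 2 = 0 then x else y) = m * (x + y) := by
    intro m
    induction m with
    | zero => simp
    | succ m ih =>
      have h1 : (m + m) % 2 = 0 := by omega
      have h2 : ¬ (m + m + 1) % 2 = 0 := by omega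
      rw [show m + 1 + (m + 1) = m + m + 1 + 1 by ring, sum_range_succ, sum_range_succ, ih,
        if_pos h1, if_neg h2]
      push_cast
      ring
  rw [Fin.sum_univ_eq_sum_range (fun k => if k % 2 = 0 then x else y), hsum]
  have hm : (m : ℝ) ≠ 0 := by
    have : m ≠ 0 := by omega
    exact_mod_cast this
  push_cast
  field_simp
  ring

/-- One communication round of a family of scalar affine recursions that are averaged every
`E` steps. -/
lemma periodic_average_step {K E : ℕ} (hE : 1 ≤ E) {lam ρ : ℝ} {n c : Fin K → ℝ}
    (hc : ∀ k, (1 - n k) * c k = lam) {x : ℕ → Fin K → ℝ}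
    (hx : ∀ t k, x (t + 1) k =
      if (t + 1) % E = 0 then ((K : ℝ)⁻¹) * ∑ j, (n j * x t j + lam * ρ)
      else n k * x t k + lam * ρ)
    {r : ℕ} {y : ℝ} (hy : ∀ k, x (r * E) k = y) (k : Fin K) :
    x ((r + 1) * E) k =
      ((K : ℝ)⁻¹) * ∑ j, (n j ^ E * y + (1 - n j ^ E) * c j * ρ) := by
  have hloc : ∀ i, i < E → ∀ k,
      x (r * E + i) k = n k ^ i * y + (1 - n k ^ i) * c k * ρ := by
    intro i
    induction i with
    | zero => intro _ k; simp [hy]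
    | succ i ih =>
      intro hi k
      have hmod : ¬ (r * E + i + 1) % E = 0 := by
        rw [show r * E + i + 1 = (i + 1) + r * E by ring, Nat.add_mul_mod_self_right,
          Nat.mod_eq_of_lt hi]
        omega
      rw [← add_assoc, hx, if_neg hmod, ih (by omega), ← hc k]
      ring
  obtain ⟨e, rfl⟩ : ∃ e, E = e + 1 := ⟨E - 1, by omega⟩
  have hmod : (r * (e + 1) + e + 1) % (e + 1) = 0 := by
    rw [show r * (e + 1) + e + 1 = (r + 1) * (e + 1) by ring, Nat.mul_mod_left]
  rw [show (r + 1) * (e + 1) = r * (e + 1) + e + 1 by ring, hx, if_pos hmod]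
  congr 1
  refine sum_congr rfl fun j _ => ?_
  rw [hloc e (by omega), ← hc j]
  ring

/-- Secant slopes of `t ↦ -(1 - p t) ^ E` are at least `p / q` times those of
`t ↦ -(1 - q t) ^ E` when `p ≤ q`. -/
lemma drift_mono {E : ℕ} {p q μ l : ℝ} (hp : 0 < p) (hpq : p ≤ q) (hμ : 0 ≤ μ) (hμl : μ ≤ l)
    (hl : q * l ≤ 1) :
    (1 - (1 - p * μ) ^ E) / p - (1 - (1 - q * μ) ^ E) / q ≤
      (1 - (1 - p * l) ^ E) / p - (1 - (1 - q * l) ^ E) / q := by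
  have hq : 0 < q := hp.trans_le hpq
  have key : ∀ s : ℝ, 0 < s → (1 - (1 - s * l) ^ E) / s - (1 - (1 - s * μ) ^ E) / s =
      (l - μ) * ∑ i ∈ range E, (1 - s * μ) ^ i * (1 - s * l) ^ (E - 1 - i) := by
    intro s hs
    have h := geom_sum₂_mul (1 - s * μ) (1 - s * l) E
    rw [← sub_div, div_eq_iff hs.ne']
    linear_combination -h
  have hsum : ∑ i ∈ range E, (1 - q * μ) ^ i * (1 - q * l) ^ (E - 1 - i) ≤
      ∑ i ∈ range E, (1 - p * μ) ^ i * (1 - p * l) ^ (E - 1 - i) := by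
    have h0 : 0 ≤ 1 - q * l := by linarith
    have h1 : 0 ≤ 1 - q * μ := by nlinarith
    have h2 : 0 ≤ 1 - p * μ := by nlinarith
    have h3 : 0 ≤ l := hμ.trans hμl
    refine sum_le_sum fun i _ => ?_
    gcongr
  have := mul_le_mul_of_nonneg_left hsum (sub_nonneg.2 hμl)
  rw [← key p hp, ← key q hq] at this
  linarith

/-- Quadratic lower bound for the drift gap at small stepsizes. -/
lemma drift_quadratic {E : ℕ} {p q μ : ℝ} (hp : 0 < p) (hpq : p ≤ q) (hμ : 0 ≤ μ)
    (hμE : 2 * E * (q * μ) ≤ 1) :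
    (q - p) * μ ^ 2 * (E * (E - 1)) / 4 ≤
      (1 - (1 - p * μ) ^ E) / p - (1 - (1 - q * μ) ^ E) / q := by
  have hq : 0 < q := hp.trans_le hpq
  have hqμ : 0 ≤ q * μ := by positivity
  have key : ∀ s : ℝ, 0 < s → (1 - (1 - s * μ) ^ E) / s =
      μ * ∑ i ∈ range E, (1 - s * μ) ^ i := by
    intro s hs
    have h := geom_sum_mul (1 - s * μ) E
    rw [div_eq_iff hs.ne']
    linear_combination h
  have hterm : ∀ i ∈ range E, (q - p) * μ / 2 * i ≤ (1 - p * μ) ^ i - (1 - q * μ) ^ i := by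
    intro i hi
    have hiE : (i : ℝ) + 1 ≤ E := by exact_mod_cast mem_range.1 hi
    have hE1 : (1 : ℝ) ≤ E := by linarith [(Nat.cast_nonneg i : (0 : ℝ) ≤ i)]
    have hqμ1 : q * μ ≤ 1 / 2 := by nlinarith
    have h0 : 0 ≤ 1 - q * μ := by linarith
    have hpm : p * μ ≤ q * μ := by gcongr
    rw [← geom_sum₂_mul (1 - p * μ) (1 - q * μ) i]
    have hhalf : ∀ m : ℕ, m ≤ E → (1 : ℝ) / 2 ≤ (1 - q * μ) ^ m := by
      intro m hm
      have hb := one_add_mul_le_pow (a := -(q * μ)) (by linarith) m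
      have hm' : (m : ℝ) ≤ E := by exact_mod_cast hm
      have : (m : ℝ) * (q * μ) ≤ E * (q * μ) := by gcongr
      rw [← sub_eq_add_neg] at hb
      linarith
    have hsum : (i : ℝ) * (1 / 2) ≤
        ∑ j ∈ range i, (1 - p * μ) ^ j * (1 - q * μ) ^ (i - 1 - j) := by
      have : ∑ j ∈ range i, (1 / 2 : ℝ) ≤
          ∑ j ∈ range i, (1 - p * μ) ^ j * (1 - q * μ) ^ (i - 1 - j) := by
        refine sum_le_sum fun j hj => ?_
        have hji := mem_range.1 hj
        have hiE' := mem_range.1 hi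
        calc (1 / 2 : ℝ) ≤ (1 - q * μ) ^ (i - 1) := hhalf _ (by omega)
          _ = (1 - q * μ) ^ j * (1 - q * μ) ^ (i - 1 - j) := by
            rw [← pow_add]; congr 1; omega
          _ ≤ _ := by gcongr
      simpa using this
    have := mul_le_mul_of_nonneg_right hsum
      (show 0 ≤ (1 - p * μ) - (1 - q * μ) by linarith)
    linarith
  have hgauss : ∀ m : ℕ, ∑ i ∈ range m, (i : ℝ) = m * (m - 1) / 2 := by
    intro m
    induction m with
    | zero => simp
    | succ m ih => rw [sum_range_succ, ih]; push_cast; ring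
  have hsum := sum_le_sum hterm
  rw [← mul_sum, hgauss, sum_sub_distrib] at hsum
  rw [key p hp, key q hq, ← mul_sub]
  calc _ = μ * ((q - p) * μ / 2 * (E * (E - 1) / 2)) := by ring
    _ ≤ _ := by gcongr

/-- For small stepsizes the symmetric mode has not yet contracted. -/
lemma inv_exp_mul_le_pow_of_small_stepsize {E r : ℕ} (hE : 2 ≤ E) (hr : 2 ≤ r) {x : ℝ}
    (hL : 6 ≤ Real.log r) (hx1 : Real.log r / (r * E) ≤ 1 / 4)
    (hxl : x ≤ Real.log r / (r * E)) :
    1 / (Real.exp 1 * r) ≤ (1 - x) ^ (r * E) := by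
  have hr0 : (0 : ℝ) < r := by positivity
  have hE0 : (2 : ℝ) ≤ E := by exact_mod_cast hE
  set L := Real.log r with hLdef
  set z := L / (r * E) with hz
  have hz0 : 0 < z := by positivity
  have hzn : z * (r * E) = L := by rw [hz]; field_simp
  have hexpL : Real.exp L = r := Real.exp_log hr0
  have hzL : z * L ≤ 1 / 2 := by
    have h3 := Real.pow_div_factorial_le_exp L (by linarith) 3
    rw [hexpL] at h3
    norm_num [Nat.factorial] at h3
    have h4 : L ^ 2 ≤ r := by nlinarith [sq_nonneg L]
    rw [hz, div_mul_eq_mul_div, div_le_iff₀ (by positivity)]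
    nlinarith
  have hlog : -(z / (1 - z)) ≤ Real.log (1 - z) := by
    have h := Real.one_sub_inv_le_log_of_pos (show 0 < 1 - z by linarith)
    have : 1 - (1 - z)⁻¹ = -(z / (1 - z)) := by
      have : 1 - z ≠ 0 := by linarith
      field_simp
      ring
    linarith
  have hpow : 1 / (Real.exp 1 * r) ≤ (1 - z) ^ (r * E) := by
    rw [← Real.exp_log (show 0 < 1 - z by linarith), ← Real.exp_nat_mul, ← hexpL, ← Real.exp_add,
      one_div, ← Real.exp_neg, Real.exp_le_exp]
    push_cast
    have h1 : (r * E : ℝ) * (-(z / (1 - z))) ≤ r * E * Real.log (1 - z) := by gcongr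
    have h2 : (r * E : ℝ) * (z / (1 - z)) ≤ 1 + L := by
      rw [← mul_div_assoc, div_le_iff₀ (by linarith)]
      nlinarith
    linarith
  refine hpow.trans ?_
  have : 0 ≤ 1 - z := by linarith
  gcongr

lemma six_mul_le_four_mul {γ e : ℝ} (hγ0 : 0 < γ) (hγ1 : γ < 1) (he : 2 ≤ e) :
    6 * ((1 + γ) * γ ^ 2 * (e - 1)) ≤ 4 * e * (γ + 2) := by
  have h1 : (1 + γ) * γ ^ 2 ≤ 2 * γ := by nlinarith [mul_pos hγ0 hγ0]
  have h2 : (1 + γ) * γ ^ 2 * (e - 1) ≤ 2 * γ * (e - 1) := by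
    have : 0 ≤ e - 1 := by linarith
    gcongr
  nlinarith

/-- Above the critical stepsize, the drift relative to the contraction is at least `2 / r`. -/
lemma relative_drift_lower_bound {E r : ℕ} (hE : 2 ≤ E) (hr : 2 ≤ r) {γ l : ℝ} (hγ0 : 0 < γ)
    (hγ1 : γ < 1) (hl : 0 < l) (hl1 : (1 + γ) * l ≤ 1)
    (hL : 4 * E * (γ + 2) / ((1 + γ) * γ ^ 2 * ((E : ℝ) - 1)) ≤ Real.log r)
    (hl0 : Real.log r / (r * E) ≤ (1 - γ) * l) :
    2 / r * (((1 - (1 - (1 + γ) * l) ^ E) + (1 - (1 - (1 - γ) * l) ^ E))) ≤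
      γ * ((1 - (1 - (1 - γ) * l) ^ E) / (1 - γ) - (1 - (1 - (1 + γ) * l) ^ E) / (1 + γ)) := by
  have hr0 : (0 : ℝ) < r := by positivity
  have hE0 : (2 : ℝ) ≤ E := by exact_mod_cast hE
  have hp : 0 < 1 - γ := by linarith
  have hpq : 1 - γ ≤ 1 + γ := by linarith
  have hE1 : (0 : ℝ) < E - 1 := by linarith
  set X := 4 * E * (γ + 2) / ((1 + γ) * γ ^ 2 * ((E : ℝ) - 1)) with hX
  have hXmul : X * ((1 + γ) * γ ^ 2 * ((E : ℝ) - 1)) = 4 * E * (γ + 2) := by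
    rw [hX]; field_simp
  have hν1 : 0 ≤ 1 - (1 + γ) * l := by linarith
  have hν2 : 0 ≤ 1 - (1 - γ) * l := by nlinarith
  rcases le_total (2 * E * ((1 + γ) * l)) 1 with hsmall | hlarge
  · have hq := drift_quadratic hp hpq hl.le hsmall
    have hb1 := one_add_mul_le_pow (a := -((1 + γ) * l)) (by linarith) E
    have hb2 := one_add_mul_le_pow (a := -((1 - γ) * l)) (by linarith) E
    rw [← sub_eq_add_neg] at hb1 hb2
    have hden : (1 - (1 - (1 + γ) * l) ^ E) + (1 - (1 - (1 - γ) * l) ^ E) ≤ 2 * E * l := by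
      linarith
    have hX' : X / (r * E) ≤ (1 - γ) * l := le_trans (by gcongr) hl0
    rw [div_le_iff₀ (by positivity)] at hX'
    have hmain : 8 ≤ γ ^ 2 * l * (E - 1) * r := by
      have h1 : 4 * E * (γ + 2) ≤ (1 - γ) * l * (r * E) * ((1 + γ) * γ ^ 2 * ((E : ℝ) - 1)) := by
        rw [← hXmul]; gcongr
      have h2 : 4 * (γ + 2) ≤ (1 - γ ^ 2) * (γ ^ 2 * l * (E - 1) * r) := by
        have hEp : (0 : ℝ) < E := by linarith
        refine le_of_mul_le_mul_left ?_ hEp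
        linarith
      have h3 : 0 ≤ γ ^ 2 * (γ ^ 2 * l * (E - 1) * r) := by positivity
      linarith
    calc _ ≤ 2 / r * (2 * E * l) := by gcongr
      _ = E * l * (8 / r) / 2 := by ring
      _ ≤ E * l * (γ ^ 2 * l * (E - 1)) / 2 := by
        have : 8 / r ≤ γ ^ 2 * l * (E - 1) := by rwa [div_le_iff₀ hr0]
        gcongr
      _ = γ * ((1 + γ - (1 - γ)) * l ^ 2 * (E * (E - 1)) / 4) := by ring
      _ ≤ _ := by gcongr
  · set μ := 1 / (2 * E * (1 + γ)) with hμ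
    have hμ0 : 0 < μ := by positivity
    have hμE : 2 * E * ((1 + γ) * μ) = 1 := by rw [hμ]; field_simp
    have hμl : μ ≤ l := by
      rw [hμ, div_le_iff₀ (by positivity)]; linarith
    have hq := (drift_quadratic hp hpq hμ0.le hμE.le).trans (drift_mono (E := E) hp hpq hμ0.le hμl hl1)
    have hden : (1 - (1 - (1 + γ) * l) ^ E) + (1 - (1 - (1 - γ) * l) ^ E) ≤ 2 := by
      linarith [pow_nonneg hν1 E, pow_nonneg hν2 E]
    have hX6 : 6 ≤ X := by
      rw [hX, le_div_iff₀ (by positivity)]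
      exact six_mul_le_four_mul hγ0 hγ1 hE0
    have hrX : 64 * X ≤ r := by
      have h1 : Real.exp X ≤ r := by
        rw [← Real.exp_log hr0]; exact Real.exp_le_exp.2 hL
      have h2 : Real.exp X = Real.exp 1 ^ 6 * Real.exp (X - 6) := by
        rw [← Real.exp_nat_mul, ← Real.exp_add]; norm_num
      have h3 : (387 : ℝ) ≤ Real.exp 1 ^ 6 := by
        have h := Real.exp_one_gt_d9
        calc (387 : ℝ) ≤ 2.7 ^ 6 := by norm_num
          _ ≤ Real.exp 1 ^ 6 := by
            gcongr
            linarith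
      have h4 := Real.add_one_le_exp (X - 6)
      have h5 : 387 * (X - 6 + 1) ≤ Real.exp 1 ^ 6 * Real.exp (X - 6) := by
        gcongr
      linarith
    have hmain : 4 / r ≤ γ * ((1 + γ - (1 - γ)) * μ ^ 2 * (E * (E - 1)) / 4) := by
      have h1 : γ * ((1 + γ - (1 - γ)) * μ ^ 2 * (E * (E - 1)) / 4) =
          γ ^ 2 * (E - 1) / (8 * E * (1 + γ) ^ 2) := by
        rw [hμ]; field_simp; ring
      rw [h1, div_le_div_iff₀ hr0 (by positivity)]
      have h2 : 64 * (4 * E * (γ + 2)) ≤ r * ((1 + γ) * γ ^ 2 * ((E : ℝ) - 1)) := by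
        rw [← hXmul, ← mul_assoc]; gcongr
      have h3 : (1 + γ) ^ 3 ≤ 4 * (γ + 2) := by nlinarith [mul_pos hγ0 hγ0]
      have h4 : 0 < 1 + γ := by linarith
      have hEp : (0 : ℝ) < E := by linarith
      refine le_of_mul_le_mul_left ?_ h4
      have h5 : 32 * (E * (1 + γ) ^ 3) ≤ 64 * (4 * E * (γ + 2)) := by
        have : E * (1 + γ) ^ 3 ≤ E * (4 * (γ + 2)) := by gcongr
        have : 0 < E * (γ + 2) := by positivity
        linarith
      linarith
    calc _ ≤ 2 / (r : ℝ) * 2 := by gcongr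
      _ = 4 / (r : ℝ) := by ring
      _ ≤ _ := hmain
      _ ≤ _ := by gcongr

/-- Either the symmetric mode or the antisymmetric mode of the averaged error is still of
order `1 / r` after `r` rounds. -/
lemma mode_lower_bound {E r : ℕ} (hE : 2 ≤ E) (hr : 2 ≤ r) {γ l α κ : ℝ} (hγ0 : 0 < γ)
    (hγ1 : γ < 1) (hl : 0 < l) (hl1 : (1 + γ) * l ≤ 1)
    (hα : α = ((1 - (1 + γ) * l) ^ E + (1 - (1 - γ) * l) ^ E) / 2)
    (hκ : κ = -(γ / 2) * ((1 - (1 - (1 - γ) * l) ^ E) / (1 - γ) -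
      (1 - (1 - (1 + γ) * l) ^ E) / (1 + γ)))
    (hL : 4 * E * (γ + 2) / ((1 + γ) * γ ^ 2 * ((E : ℝ) - 1)) ≤ Real.log r)
    (hL2 : (1 + γ) * Real.log r / ((1 - γ) * r * E) ≤ 1 / (2 * E)) :
    1 / (Real.exp 1 * r) ≤ (1 - (1 - γ) * l) ^ (r * E) ∨
      1 / (Real.exp 1 * r) ≤ |α ^ r + κ * ∑ i ∈ range r, α ^ i| := by
  have hr0 : (0 : ℝ) < r := by positivity
  have hE0 : (2 : ℝ) ≤ E := by exact_mod_cast hE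
  have hp : 0 < 1 - γ := by linarith
  have hE1 : (0 : ℝ) < E - 1 := by linarith
  have hL6 : 6 ≤ Real.log r := by
    refine le_trans ?_ hL
    rw [le_div_iff₀ (by positivity)]
    exact six_mul_le_four_mul hγ0 hγ1 hE0
  have hν1 : 0 ≤ 1 - (1 + γ) * l := by linarith
  have hν2 : 0 ≤ 1 - (1 - γ) * l := by nlinarith
  have hν12 : 1 - (1 + γ) * l ≤ 1 - (1 - γ) * l := by nlinarith
  rcases le_total ((1 - γ) * l) (Real.log r / (r * E)) with hsmall | hlarge
  · left
    refine inv_exp_mul_le_pow_of_small_stepsize hE hr hL6 ?_ hsmall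
    rw [div_le_div_iff₀ (by positivity) (by positivity)] at hL2 ⊢
    have hEp : (0 : ℝ) < E := by linarith
    have h1 : (1 + γ) * Real.log r * 2 ≤ 1 * ((1 - γ) * r) := by
      refine le_of_mul_le_mul_right ?_ hEp
      linarith
    have h2 : 2 * Real.log r ≤ r := by nlinarith
    nlinarith
  · right
    have hα0 : 0 ≤ α := by rw [hα]; positivity
    have hαν : α ≤ (1 - (1 - γ) * l) ^ E := by
      have : (1 - (1 + γ) * l) ^ E ≤ (1 - (1 - γ) * l) ^ E := by gcongr
      rw [hα]; linarith
    have hν2lt : (1 - (1 - γ) * l) ^ E < 1 := by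
      refine pow_lt_one₀ hν2 ?_ (by omega)
      have : 0 < (1 - γ) * l := by positivity
      linarith
    have hαlt : 0 < 1 - α := by linarith
    have hαr : α ^ r ≤ 1 / r := by
      calc α ^ r ≤ ((1 - (1 - γ) * l) ^ E) ^ r := by gcongr
        _ = (1 - (1 - γ) * l) ^ (r * E) := by rw [← pow_mul, mul_comm E r]
        _ ≤ Real.exp (-((1 - γ) * l)) ^ (r * E) := by
          gcongr
          exact Real.one_sub_le_exp_neg _
        _ = Real.exp (-((1 - γ) * l * (r * E))) := by
          rw [← Real.exp_nat_mul]; push_cast; congr 1; ring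
        _ ≤ Real.exp (-Real.log r) := by
          rw [div_le_iff₀ (by positivity)] at hlarge
          gcongr
        _ = 1 / r := by rw [Real.exp_neg, Real.exp_log hr0, one_div]
    have hdrift := relative_drift_lower_bound hE hr hγ0 hγ1 hl hl1 hL hlarge
    have hκ' : 2 / r * (1 - α) ≤ -κ := by rw [hκ, hα]; linarith
    have hgeom := mul_neg_geom_sum α r
    have hsum : 2 / r * (1 - α ^ r) ≤ -(κ * ∑ i ∈ range r, α ^ i) := by
      rw [← hgeom, ← mul_assoc, ← neg_mul]
      gcongr
    have hr6 : (6 : ℝ) ≤ r := hL6.trans ((Real.log_le_sub_one_of_pos hr0).trans (by linarith))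
    have hinv : 1 / (r : ℝ) ≤ 1 / 6 := by gcongr
    have he : 1 / (Real.exp 1 * r) ≤ 1 / 2 * (1 / r) := by
      have := Real.exp_one_gt_d9
      rw [div_mul_div_comm, one_mul]
      gcongr
      linarith
    have hir : 0 < 1 / (r : ℝ) := by positivity
    have h2 : 2 / (r : ℝ) = 2 * (1 / r) := by ring
    rw [abs_of_nonpos]
    · rw [h2] at hsum
      nlinarith
    · rw [h2] at hsum
      nlinarith

/-- **Lower bound on the convergence rate of synchronous federated Q-learning with
heterogeneous environments.** In the two-state construction with zero initialization,
for `E ≥ 2`, `(I−P̄)R ≠ 0`, `P̄R ≠ 0`, and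
`c_R = min{‖(I−P̄)R‖₂, ‖P̄R‖₂/(1−γ)} > 0`, every integer `r ≥ 2` with
`log r ≥ 4E(γ+2)/((1+γ)γ²(E−1))` and `(1+γ)·log r/((1−γ)rE) ≤ 1/(2E)` satisfies
`‖Δ_{rE}‖∞ ≥ (c_R/(√2·e))·(E/(rE))`. -/
theorem lower_bound_federated_Q_learning
    (γ lam : ℝ) (hγ : γ ∈ Set.Ioo (0:ℝ) 1) (hlam : lam ∈ Set.Ioc (0:ℝ) (1 / (1 + γ)))
    (K : ℕ) (hK : 2 ≤ K) (hKeven : Even K)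
    (P : Fin K → Matrix (Fin 2) (Fin 2) ℝ)
    (hP : ∀ k : Fin K, P k =
      if (k : ℕ) % 2 = 0 then (1 : Matrix (Fin 2) (Fin 2) ℝ) else !![0, 1; 1, 0])
    (Pbar : Matrix (Fin 2) (Fin 2) ℝ) (hPbar : Pbar = ((K : ℝ)⁻¹) • ∑ k, P k)
    (A : Fin K → Matrix (Fin 2) (Fin 2) ℝ)
    (hA : ∀ k, A k = (1 - lam) • (1 : Matrix (Fin 2) (Fin 2) ℝ) + (lam * γ) • P k)
    (Abar : ℕ → Matrix (Fin 2) (Fin 2) ℝ)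
    (hAbar : ∀ ℓ, Abar ℓ = ((K : ℝ)⁻¹) • ∑ k, (A k) ^ ℓ)
    (E : ℕ) (hE : 1 ≤ E)
    (R : Fin 2 → ℝ)
    (Qstar : Fin 2 → ℝ)
    (hQstar : ((1 : Matrix (Fin 2) (Fin 2) ℝ) - γ • Pbar) *ᵥ Qstar = R)
    (Q : ℕ → Fin K → Fin 2 → ℝ)
    (hQ0 : ∀ k, Q 0 k = 0)
    (hQrec : ∀ t k, Q (t + 1) k =
      if (t + 1) % E = 0 then ((K : ℝ)⁻¹) • ∑ j, (A j *ᵥ Q t j + lam • R)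
      else A k *ᵥ Q t k + lam • R)
    (Δ : ℕ → Fin 2 → ℝ) (hΔ : ∀ t, Δ t = Qstar - ((K : ℝ)⁻¹) • ∑ k, Q t k)
    (ν₁ ν₂ αE βE κE : ℝ)
    (hν₁ : ν₁ = 1 - (1 + γ) * lam) (hν₂ : ν₂ = 1 - (1 - γ) * lam)
    (hαE : αE = (ν₁ ^ E + ν₂ ^ E) / 2) (hβE : βE = ν₂ ^ E)
    (hκE : κE = -(γ / 2) * ((1 - ν₂ ^ E) / (1 - γ) - (1 - ν₁ ^ E) / (1 + γ)))
    (hE2 : 2 ≤ E)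
    (hR1 : ((1 : Matrix (Fin 2) (Fin 2) ℝ) - Pbar) *ᵥ R ≠ 0)
    (hR2 : Pbar *ᵥ R ≠ 0)
    (cR : ℝ)
    (hcR : cR = min
      (Real.sqrt (∑ i, ((((1 : Matrix (Fin 2) (Fin 2) ℝ) - Pbar) *ᵥ R) i) ^ 2))
      (Real.sqrt (∑ i, ((Pbar *ᵥ R) i) ^ 2) / (1 - γ))) :
    0 < cR ∧
    ∀ r : ℕ, 2 ≤ r →
      4 * E * (γ + 2) / ((1 + γ) * γ ^ 2 * ((E : ℝ) - 1)) ≤ Real.log r →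
      (1 + γ) * Real.log r / ((1 - γ) * r * E) ≤ 1 / (2 * E) →
      cR / (Real.sqrt 2 * Real.exp 1) * ((E : ℝ) / ((r : ℝ) * E))
        ≤ ⨆ i, |Δ (r * E) i| := by
  obtain ⟨hγ0, hγ1⟩ := hγ
  obtain ⟨hl, hl1⟩ := hlam
  have hp : 0 < 1 - γ := by linarith
  have hq : 0 < 1 + γ := by linarith
  rw [le_div_iff₀ hq] at hl1
  have hl1' : (1 + γ) * lam ≤ 1 := by linarith
  have hK0 : (K : ℝ) ≠ 0 := by positivity
  have havg := fun x y => inv_mul_sum_alternating hK hKeven x y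
  have hconst : ∀ x : ℝ, (K : ℝ)⁻¹ * ∑ _k : Fin K, x = x := by
    intro x
    have := havg x x
    simp only [ite_self] at this
    linarith
  have hPbar' : Pbar = !![1 / 2, 1 / 2; 1 / 2, 1 / 2] := by
    have hentry : ∀ i j, Pbar i j =
        ((1 : Matrix (Fin 2) (Fin 2) ℝ) i j + (!![0, 1; 1, 0] : Matrix (Fin 2) (Fin 2) ℝ) i j) / 2 := by
      intro i j
      rw [hPbar, Matrix.smul_apply, Matrix.sum_apply, smul_eq_mul, ← havg]
      congr 1
      refine sum_congr rfl fun k _ => ?_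
      rw [hP]
      split_ifs <;> rfl
    ext i j
    rw [hentry]
    fin_cases i <;> fin_cases j <;> simp
  have hAsum : ∀ k v, (A k *ᵥ v) 0 + (A k *ᵥ v) 1 = ν₂ * (v 0 + v 1) := by
    intro k v
    rw [hA, hP, hν₂]
    split_ifs <;>
      simp [Matrix.mulVec, dotProduct, Fin.sum_univ_two, Matrix.one_apply] <;> ring
  have hAdiff : ∀ k v, (A k *ᵥ v) 0 - (A k *ᵥ v) 1 =
      (if (k : ℕ) % 2 = 0 then ν₂ else ν₁) * (v 0 - v 1) := by
    intro k v
    rw [hA, hP, hν₂, hν₁]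
    split_ifs <;>
      simp [Matrix.mulVec, dotProduct, Fin.sum_univ_two, Matrix.one_apply] <;> ring
  have hQs := congrFun hQstar
  have hQ0' := hQs 0
  have hQ1' := hQs 1
  simp [hPbar', Matrix.mulVec, dotProduct, Fin.sum_univ_two, Matrix.one_apply] at hQ0' hQ1'
  have hstar_sum : Qstar 0 + Qstar 1 = (R 0 + R 1) / (1 - γ) := by
    rw [eq_div_iff hp.ne']; linarith
  have hstar_diff : Qstar 0 - Qstar 1 = R 0 - R 1 := by linarith
  have hsym : ∀ r k, Q (r * E) k 0 + Q (r * E) k 1 =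
      (1 - ν₂ ^ (r * E)) * ((R 0 + R 1) / (1 - γ)) := by
    intro r
    induction r with
    | zero => intro k; simp [hQ0]
    | succ r ih =>
      intro k
      rw [periodic_average_step (x := fun t k => Q t k 0 + Q t k 1) (n := fun _ => ν₂)
        (c := fun _ => 1 / (1 - γ)) (lam := lam) (ρ := R 0 + R 1) hE
        (by intro _; rw [hν₂]; field_simp; ring) ?_ ih k, hconst, Nat.succ_mul, pow_add]
      · ring
      · intro t k
        simp only [hQrec]
        split_ifs
        · simp only [Pi.smul_apply, Finset.sum_apply, Pi.add_apply, smul_eq_mul]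
          rw [← mul_add, ← sum_add_distrib]
          congr 1
          refine sum_congr rfl fun j _ => ?_
          rw [← hAsum]; ring
        · simp only [Pi.smul_apply, Pi.add_apply, smul_eq_mul]
          rw [← hAsum]; ring
  have hanti : ∀ r k, Q (r * E) k 0 - Q (r * E) k 1 =
      (1 - (αE ^ r + κE * ∑ i ∈ range r, αE ^ i)) * (R 0 - R 1) := by
    intro r
    induction r with
    | zero => intro k; simp [hQ0]
    | succ r ih =>
      intro k
      rw [periodic_average_step (x := fun t k => Q t k 0 - Q t k 1)
        (n := fun k => if (k : ℕ) % 2 = 0 then ν₂ else ν₁)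
        (c := fun k => if (k : ℕ) % 2 = 0 then 1 / (1 - γ) else 1 / (1 + γ))
        (lam := lam) (ρ := R 0 - R 1) hE
        (by intro _; split_ifs <;> simp only [hν₂, hν₁] <;> field_simp <;> ring) ?_ ih k]
      · set y := (1 - (αE ^ r + κE * ∑ i ∈ range r, αE ^ i)) * (R 0 - R 1) with hy
        have hite := havg (ν₂ ^ E * y + (1 - ν₂ ^ E) * (1 / (1 - γ)) * (R 0 - R 1))
          (ν₁ ^ E * y + (1 - ν₁ ^ E) * (1 / (1 + γ)) * (R 0 - R 1))
        have hsplit : ∀ j : Fin K,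
            (if (j : ℕ) % 2 = 0 then ν₂ else ν₁) ^ E * y +
              (1 - (if (j : ℕ) % 2 = 0 then ν₂ else ν₁) ^ E) *
                (if (j : ℕ) % 2 = 0 then 1 / (1 - γ) else 1 / (1 + γ)) * (R 0 - R 1) =
            if (j : ℕ) % 2 = 0 then ν₂ ^ E * y + (1 - ν₂ ^ E) * (1 / (1 - γ)) * (R 0 - R 1)
              else ν₁ ^ E * y + (1 - ν₁ ^ E) * (1 / (1 + γ)) * (R 0 - R 1) := by
          intro j; split_ifs <;> rfl
        simp only [hsplit]
        rw [hite, geom_sum_succ]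
        have hfix : ((1 - ν₂ ^ E) * (1 / (1 - γ)) + (1 - ν₁ ^ E) * (1 / (1 + γ))) / 2 =
            1 - αE - κE := by
          rw [hαE, hκE]; field_simp; ring
        rw [show (ν₂ ^ E * y + (1 - ν₂ ^ E) * (1 / (1 - γ)) * (R 0 - R 1) +
            (ν₁ ^ E * y + (1 - ν₁ ^ E) * (1 / (1 + γ)) * (R 0 - R 1))) / 2 =
            (ν₁ ^ E + ν₂ ^ E) / 2 * y + ((1 - ν₂ ^ E) * (1 / (1 - γ)) +
              (1 - ν₁ ^ E) * (1 / (1 + γ))) / 2 * (R 0 - R 1) by ring, hfix, ← hαE, hy]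
        ring
      · intro t k
        simp only [hQrec]
        split_ifs with h1 h2
        · simp only [Pi.smul_apply, Finset.sum_apply, Pi.add_apply, smul_eq_mul]
          rw [← mul_sub, ← sum_sub_distrib]
          congr 1
          refine sum_congr rfl fun j _ => ?_
          rw [← hAdiff]; ring
        all_goals
          have h := hAdiff k (Q t k)
          simp only [h2, if_true, if_false] at h
          simp only [Pi.smul_apply, Pi.add_apply, smul_eq_mul]
          rw [← h]; ring
  have hΔsum : ∀ r, Δ (r * E) 0 + Δ (r * E) 1 =
      ν₂ ^ (r * E) * ((R 0 + R 1) / (1 - γ)) := by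
    intro r
    have h := hconst ((1 - ν₂ ^ (r * E)) * ((R 0 + R 1) / (1 - γ)))
    rw [← sum_congr rfl fun k _ => hsym r k, sum_add_distrib] at h
    rw [hΔ]
    simp only [Pi.sub_apply, Pi.smul_apply, Finset.sum_apply, smul_eq_mul]
    linarith
  have hΔdiff : ∀ r, Δ (r * E) 0 - Δ (r * E) 1 =
      (αE ^ r + κE * ∑ i ∈ range r, αE ^ i) * (R 0 - R 1) := by
    intro r
    have h := hconst ((1 - (αE ^ r + κE * ∑ i ∈ range r, αE ^ i)) * (R 0 - R 1))
    rw [← sum_congr rfl fun k _ => hanti r k, sum_sub_distrib] at h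
    rw [hΔ]
    simp only [Pi.sub_apply, Pi.smul_apply, Finset.sum_apply, smul_eq_mul]
    linarith
  have hdiff_ne : R 0 - R 1 ≠ 0 := by
    intro h
    apply hR1
    ext i
    fin_cases i <;>
      simp [hPbar', Matrix.mulVec, dotProduct, Fin.sum_univ_two, Matrix.one_apply] <;> linarith
  have hsum_ne : R 0 + R 1 ≠ 0 := by
    intro h
    apply hR2
    ext i
    fin_cases i <;>
      simp [hPbar', Matrix.mulVec, dotProduct, Fin.sum_univ_two] <;> linarith
  have hsqrt : ∀ x : ℝ, Real.sqrt (x ^ 2 / 2) = |x| / Real.sqrt 2 := by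
    intro x
    rw [Real.sqrt_div (sq_nonneg x), Real.sqrt_sq_eq_abs]
  have hnorm1 : ∑ i, ((((1 : Matrix (Fin 2) (Fin 2) ℝ) - Pbar) *ᵥ R) i) ^ 2 =
      (R 0 - R 1) ^ 2 / 2 := by
    simp [hPbar', Matrix.mulVec, dotProduct, Fin.sum_univ_two, Matrix.one_apply]
    ring
  have hnorm2 : ∑ i, ((Pbar *ᵥ R) i) ^ 2 = (R 0 + R 1) ^ 2 / 2 := by
    simp [hPbar', Matrix.mulVec, dotProduct, Fin.sum_univ_two]
    ring
  rw [hnorm1, hnorm2, hsqrt, hsqrt] at hcR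
  have hs2 : 0 < Real.sqrt 2 := by positivity
  have hs2sq : Real.sqrt 2 * Real.sqrt 2 = 2 := Real.mul_self_sqrt (by norm_num)
  refine ⟨by rw [hcR]; positivity, fun r hr hL hL2 => ?_⟩
  have hr0 : (0 : ℝ) < r := by positivity
  have hE0 : (0 : ℝ) < E := by positivity
  have hc1 : cR * Real.sqrt 2 ≤ |R 0 - R 1| := by
    rw [← le_div_iff₀ hs2, hcR]; exact min_le_left _ _
  have hc2 : cR * Real.sqrt 2 ≤ |(R 0 + R 1) / (1 - γ)| := by
    rw [← le_div_iff₀ hs2, hcR, abs_div, abs_of_pos hp, div_right_comm]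
    exact min_le_right _ _
  have hbdd : BddAbove (Set.range fun i => |Δ (r * E) i|) := Set.finite_range _ |>.bddAbove
  have hM0 := le_ciSup hbdd 0
  have hM1 := le_ciSup hbdd 1
  have hlhs : cR / (Real.sqrt 2 * Real.exp 1) * ((E : ℝ) / ((r : ℝ) * E)) =
      1 / (Real.exp 1 * r) * (cR * Real.sqrt 2) / 2 := by
    have h : cR / (Real.sqrt 2 * Real.exp 1) = cR * Real.sqrt 2 / (2 * Real.exp 1) := by
      rw [div_eq_div_iff (by positivity) (by positivity)]
      linear_combination -(cR * Real.exp 1) * hs2sq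
    rw [h]
    field_simp
  rw [hlhs]
  have hw : 0 ≤ 1 / (Real.exp 1 * r) := by positivity
  rw [hν₁, hν₂] at hαE hκE
  rcases mode_lower_bound hE2 hr hγ0 hγ1 hl hl1' hαE hκE hL hL2 with h | h
  · have h1 := mul_le_mul (h.trans (le_abs_self _)) hc2 (by rw [hcR]; positivity) (abs_nonneg _)
    rw [← hν₂, ← abs_mul, ← hΔsum] at h1
    have := abs_add_le (Δ (r * E) 0) (Δ (r * E) 1)
    linarith
  · have h1 := mul_le_mul h hc1 (by rw [hcR]; positivity) (abs_nonneg _)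
    rw [← abs_mul, ← hΔdiff] at h1
    have := abs_sub (Δ (r * E) 0) (Δ (r * E) 1)
    linarith
end
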